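/- Fix a finite field 𝔽_q with q odd and let β_q = ∏_P (1 − 3/|P|² + 2/|P|³), the product over monic irreducible P ∈ 𝔽_q[t]. For every δ > 0 there exists a constant C = C(q, δ) such that for all integers n ≥ 2 and 0 ≤ h ≤ n−2, with H = q^{h+1}: |Var(N_{μ²}(•;h)) − √H·(β_q/(1 − q^{−3}))·c_q(h)| ≤ C·(H²·n·q^{−n/3} + H^{1/4+δ}), where c_q(h) = (1 + q^{−2})/√q if h is even and c_q(h) = (1 + 1/q)/q if h is odd, and Var(N_{μ²}(•;h)) = (1/q^n)·Σ_{A∈M_n} |N_{μ²}(A;h) − H·(1 − 1/q)|². -/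

import Mathlib

open Polynomial

open scoped Classical in
/-- `N_{μ²}(A;h)`: the number of squarefree polynomials in the short interval `I(A;h)`. -/
noncomputable def Nsqfree {Fq : Type} [Field Fq] (A : Fq[X]) (h : ℕ) : ℝ :=
  ∑ᶠ f ∈ {f : Fq[X] | (f - A).degree ≤ (h : WithBot ℕ)},
    (if Squarefree f then (1 : ℝ) else 0)

/-- The variance of `N_{μ²}(•;h)` over `M_n`, about the mean `H(1 - 1/q)` with `H = q^{h+1}`. -/
noncomputable def varNsqfreeHall (Fq : Type) [Field Fq] [Fintype Fq] (n h : ℕ) : ℝ :=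
  (1 / (Fintype.card Fq : ℝ) ^ n) *
    ∑ᶠ A ∈ {A : Fq[X] | A.Monic ∧ A.natDegree = n},
      (Nsqfree A h
        - (Fintype.card Fq : ℝ) ^ (h + 1) * (1 - 1 / (Fintype.card Fq : ℝ))) ^ 2

/-- `β_q = ∏_P (1 - 3/|P|² + 2/|P|³)`, the product over monic irreducible `P ∈ 𝔽_q[t]`. -/
noncomputable def betaq (Fq : Type) [Field Fq] [Fintype Fq] : ℝ :=
  ∏' P : {P : Fq[X] // P.Monic ∧ Irreducible P},
    (1 - 3 / ((Fintype.card Fq : ℝ) ^ (P : Fq[X]).natDegree) ^ 2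
       + 2 / ((Fintype.card Fq : ℝ) ^ (P : Fq[X]).natDegree) ^ 3)

/-- The parity factor `c_q(h)`: `(1 + q⁻²)/√q` for `h` even and `(1 + 1/q)/q` for `h` odd. -/
noncomputable def cqHall (Fq : Type) [Field Fq] [Fintype Fq] (h : ℕ) : ℝ :=
  if Even h then (1 + 1 / (Fintype.card Fq : ℝ) ^ 2) / Real.sqrt (Fintype.card Fq)
  else (1 + 1 / (Fintype.card Fq : ℝ)) / (Fintype.card Fq : ℝ)

namespace HallFF
open scoped Classical in
noncomputable def GF (Fq : Type) [Field Fq] [Fintype Fq] (n : ℕ) : Finset Fq[X] :=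
  Finset.univ.image (fun c : Fin n → Fq => (((degreeLTEquiv Fq n).symm c : degreeLT Fq n) : Fq[X]))

variable {Fq : Type} [Field Fq] [Fintype Fq]

lemma mem_GF {n : ℕ} {f : Fq[X]} : f ∈ GF Fq n ↔ f.degree < n := by
  classical
  simp only [GF, Finset.mem_image, Finset.mem_univ, true_and]
  rw [← mem_degreeLT]
  constructor
  · rintro ⟨c, rfl⟩
    exact ((degreeLTEquiv Fq n).symm c).2
  · intro hf
    exact ⟨degreeLTEquiv Fq n ⟨f, hf⟩, by simp⟩

lemma card_GF (n : ℕ) : (GF Fq n).card = Fintype.card Fq ^ n := by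
  classical
  rw [GF, Finset.card_image_of_injective]
  · simp
  · intro a b hab
    exact (degreeLTEquiv Fq n).symm.injective (Subtype.ext hab)

open scoped Classical in
noncomputable def MF (Fq : Type) [Field Fq] [Fintype Fq] (n : ℕ) : Finset Fq[X] :=
  (GF Fq n).image (fun g => X ^ n + g)

lemma mem_MF {n : ℕ} {f : Fq[X]} : f ∈ MF Fq n ↔ f.Monic ∧ f.natDegree = n := by
  classical
  simp only [MF, Finset.mem_image, mem_GF]
  constructor
  · rintro ⟨g, hg, rfl⟩
    exact ⟨monic_X_pow_add hg, by
      rw [natDegree_add_eq_left_of_degree_lt (by simpa using hg), natDegree_X_pow]⟩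
  · rintro ⟨hm, hn⟩
    refine ⟨f - X ^ n, ?_, by ring⟩
    have hd : f.degree = n := by rw [degree_eq_natDegree hm.ne_zero, hn]
    rw [← hd]
    apply degree_sub_lt_left
    · rw [degree_X_pow, hd]
    · exact hm.ne_zero
    · rw [hm.leadingCoeff, leadingCoeff_X_pow]

lemma card_MF (n : ℕ) : (MF Fq n).card = Fintype.card Fq ^ n := by
  classical
  rw [MF, Finset.card_image_of_injective _ (add_right_injective _), card_GF]

lemma add_mem_MF {n m : ℕ} (hmn : m ≤ n) {f g : Fq[X]} (hf : f ∈ MF Fq n) (hg : g ∈ GF Fq m) :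
    f + g ∈ MF Fq n := by
  rw [mem_MF] at *
  rw [mem_GF] at hg
  have hd : f.degree = n := by rw [degree_eq_natDegree hf.1.ne_zero, hf.2]
  have : g.degree < f.degree := by
    rw [hd]; exact lt_of_lt_of_le hg (by exact_mod_cast hmn)
  exact ⟨hf.1.add_of_left this, by rw [natDegree_add_eq_left_of_degree_lt this, hf.2]⟩

open scoped Classical in
lemma count_MF (L A0 : Fq[X]) (hL : L.Monic) (n : ℕ) (hn : L.natDegree ≤ n) :
    ((MF Fq n).filter (fun A => L ∣ A - A0)).card = Fintype.card Fq ^ (n - L.natDegree) := by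
  rw [← card_MF (Fq := Fq)]
  symm
  have hr : (A0 %ₘ L).degree < L.degree := degree_modByMonic_lt _ hL
  have hdvd : L ∣ A0 - A0 %ₘ L := ⟨A0 /ₘ L, by
    have := modByMonic_add_div A0 L; linear_combination (-1 : Fq[X]) * this⟩
  have hLd : L.degree = L.natDegree := degree_eq_natDegree hL.ne_zero
  apply Finset.card_bij (fun K _ => A0 %ₘ L + L * K)
  · intro K hK
    rw [mem_MF] at hK
    have hLK : (L * K).Monic := hL.mul hK.1
    have hnd : (L * K).natDegree = n := by rw [hL.natDegree_mul hK.1, hK.2]; omega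
    have hlt : (A0 %ₘ L).degree < (L * K).degree := by
      refine hr.trans_le ?_
      rw [degree_eq_natDegree hLK.ne_zero, hnd, hLd]; exact_mod_cast hn
    rw [Finset.mem_filter, mem_MF]
    refine ⟨⟨hLK.add_of_right hlt, by rw [natDegree_add_eq_right_of_degree_lt hlt, hnd]⟩, ?_⟩
    have : A0 %ₘ L + L * K - A0 = L * K - (A0 - A0 %ₘ L) := by ring
    rw [this]
    exact dvd_sub (dvd_mul_right _ _) hdvd
  · intro K _ K' _ h
    exact mul_left_cancel₀ hL.ne_zero (add_left_cancel h)
  · intro A hA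
    rw [Finset.mem_filter, mem_MF] at hA
    obtain ⟨⟨hm, hdeg⟩, hd⟩ := hA
    have : L ∣ A - A0 %ₘ L := by
      have : A - A0 %ₘ L = (A - A0) + (A0 - A0 %ₘ L) := by ring
      rw [this]; exact dvd_add hd hdvd
    obtain ⟨K, hK⟩ := this
    refine ⟨K, ?_, by rw [← hK]; ring⟩
    have hA : A = A0 %ₘ L + L * K := by rw [← hK]; ring
    have hlt : (A0 %ₘ L).degree < A.degree := by
      refine hr.trans_le ?_
      rw [degree_eq_natDegree hm.ne_zero, hdeg, hLd]; exact_mod_cast hn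
    have hLK : (L * K).Monic := by
      rw [← hK]; exact hm.sub_of_left hlt
    have hKm : K.Monic := hL.of_mul_monic_left hLK
    rw [mem_MF]
    refine ⟨hKm, ?_⟩
    have h1 : (L * K).natDegree = n := by
      rw [← hK, natDegree_eq_of_degree_eq (degree_sub_eq_left_of_degree_lt hlt), hdeg]
    rw [hL.natDegree_mul hKm] at h1
    omega

open scoped Classical in
lemma count_MF_le (L A0 : Fq[X]) (n : ℕ) (hn : n < L.natDegree) :
    ((MF Fq n).filter (fun A => L ∣ A - A0)).card ≤ 1 := by
  rw [Finset.card_le_one]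
  intro a ha b hb
  rw [Finset.mem_filter, mem_MF] at ha hb
  have hd : L ∣ a - b := by
    have : a - b = (a - A0) - (b - A0) := by ring
    rw [this]; exact dvd_sub ha.2 hb.2
  by_contra hne
  have h1 := natDegree_le_of_dvd hd (sub_ne_zero.mpr hne)
  have h2 := natDegree_sub_le a b
  rw [ha.1.2, hb.1.2, max_self] at h2
  omega

open scoped Classical in
lemma count_GF (L : Fq[X]) (hL : L.Monic) (m : ℕ) (hm : L.natDegree ≤ m) :
    ((GF Fq m).filter (fun A => L ∣ A)).card = Fintype.card Fq ^ (m - L.natDegree) := by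
  rw [← card_GF (Fq := Fq)]
  symm
  apply Finset.card_bij (fun K _ => L * K)
  · intro K hK
    rw [Finset.mem_filter]
    refine ⟨?_, dvd_mul_right _ _⟩
    rw [mem_GF] at hK ⊢
    by_cases h0 : K = 0
    · simp [h0]
    · rw [degree_mul, degree_eq_natDegree hL.ne_zero, degree_eq_natDegree h0]
      rw [degree_eq_natDegree h0] at hK
      norm_cast at hK ⊢; omega
  · intro K _ K' _ h
    exact mul_left_cancel₀ hL.ne_zero h
  · intro A hA
    rw [Finset.mem_filter, mem_GF] at hA
    obtain ⟨hA, K, rfl⟩ := hA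
    refine ⟨K, ?_, rfl⟩
    rw [mem_GF]
    by_cases h0 : K = 0
    · simp [h0]
    · rw [degree_mul, degree_eq_natDegree hL.ne_zero, degree_eq_natDegree h0] at hA
      rw [degree_eq_natDegree h0]
      norm_cast at hA ⊢; omega

open scoped Classical in
lemma count_GF_one (L : Fq[X]) (m : ℕ) (hm : m ≤ L.natDegree) :
    ((GF Fq m).filter (fun A => L ∣ A)).card = 1 := by
  rw [Finset.card_eq_one]
  refine ⟨0, ?_⟩
  ext A
  rw [Finset.mem_filter, mem_GF, Finset.mem_singleton]
  constructor
  · rintro ⟨h1, h2⟩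
    by_contra h0
    have := natDegree_le_of_dvd h2 h0
    rw [degree_eq_natDegree h0] at h1
    norm_cast at h1
    omega
  · rintro rfl; simp

end HallFF

namespace HallFF
abbrev PP (Fq : Type) [Field Fq] := {P : Fq[X] // P.Monic ∧ Irreducible P}

variable {Fq : Type} [Field Fq]

noncomputable def dT (T : Finset (PP Fq)) : Fq[X] := ∏ P ∈ T, P.1
noncomputable def dg (T : Finset (PP Fq)) : ℕ := ∑ P ∈ T, P.1.natDegree

lemma dT_monic (T : Finset (PP Fq)) : (dT T).Monic := monic_prod_of_monic _ _ fun P _ => P.2.1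

lemma natDegree_dT (T : Finset (PP Fq)) : (dT T).natDegree = dg T :=
  natDegree_prod_of_monic _ _ fun P _ => P.2.1

lemma PP_coprime {P Q : PP Fq} (h : P ≠ Q) : IsCoprime P.1 Q.1 := by
  rw [P.2.2.coprime_iff_not_dvd]
  intro hd
  exact h (Subtype.ext (eq_of_monic_of_associated P.2.1 Q.2.1
    (P.2.2.associated_of_dvd Q.2.2 hd)))

lemma dT_dvd_iff (T : Finset (PP Fq)) (f : Fq[X]) : dT T ∣ f ↔ ∀ P ∈ T, P.1 ∣ f := by
  constructor
  · intro h P hP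
    exact (Finset.dvd_prod_of_mem (fun P : PP Fq => P.1) hP).trans h
  · intro h
    exact Finset.prod_dvd_of_coprime (fun P _ Q _ hPQ => PP_coprime hPQ) h

lemma dT_sq_dvd_iff (T : Finset (PP Fq)) (f : Fq[X]) :
    dT T ^ 2 ∣ f ↔ ∀ P ∈ T, P.1 ^ 2 ∣ f := by
  rw [dT, ← Finset.prod_pow]
  constructor
  · intro h P hP
    exact (Finset.dvd_prod_of_mem (fun P : PP Fq => P.1 ^ 2) hP).trans h
  · intro h
    exact Finset.prod_dvd_of_coprime (fun P _ Q _ hPQ => (PP_coprime hPQ).pow) h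

lemma mem_iff_dvd_dT (T : Finset (PP Fq)) (P : PP Fq) : P ∈ T ↔ P.1 ∣ dT T := by
  constructor
  · intro h; exact Finset.dvd_prod_of_mem (fun P : PP Fq => P.1) h
  · intro h
    obtain ⟨Q, hQ, hd⟩ := (P.2.2.prime.dvd_finsetProd_iff _).mp h
    by_contra hn
    have : P ≠ Q := fun e => hn (e ▸ hQ)
    exact (P.2.2.coprime_iff_not_dvd.mp (PP_coprime this)) hd

lemma dT_injective : Function.Injective (dT : Finset (PP Fq) → Fq[X]) := by
  intro S T h
  ext P
  rw [mem_iff_dvd_dT, mem_iff_dvd_dT, h]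

lemma natDegree_pos (P : PP Fq) : 0 < P.1.natDegree := P.2.2.natDegree_pos

lemma dg_mono {S T : Finset (PP Fq)} (h : S ⊆ T) : dg S ≤ dg T :=
  Finset.sum_le_sum_of_subset h

lemma dg_empty : dg (∅ : Finset (PP Fq)) = 0 := rfl

lemma dg_eq_zero {S : Finset (PP Fq)} : dg S = 0 ↔ S = ∅ := by
  constructor
  · intro h
    rw [Finset.eq_empty_iff_forall_notMem]
    intro P hP
    have := (Finset.sum_eq_zero_iff.mp h) P hP
    have := natDegree_pos P
    omega
  · rintro rfl; rfl

lemma dg_union_add_inter [DecidableEq (PP Fq)] (S T : Finset (PP Fq)) :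
    dg (S ∪ T) + dg (S ∩ T) = dg S + dg T := Finset.sum_union_inter

variable [Fintype Fq]

lemma finite_dg (N : ℕ) : {T : Finset (PP Fq) | dg T ≤ N}.Finite := by
  classical
  apply Set.Finite.of_finite_image (f := dT) _ dT_injective.injOn
  apply (((Finset.range (N+1)).biUnion (fun n => MF Fq n)).finite_toSet).subset
  rintro _ ⟨T, hT, rfl⟩
  simp only [Finset.coe_biUnion, Set.mem_iUnion, Finset.mem_coe, mem_MF]
  refine ⟨dg T, ?_, dT_monic T, natDegree_dT T⟩
  simpa [Nat.lt_succ_iff] using hT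

noncomputable def FT (Fq : Type) [Field Fq] [Fintype Fq] (N : ℕ) : Finset (Finset (PP Fq)) :=
  (finite_dg N).toFinset

lemma mem_FT {N : ℕ} {T : Finset (PP Fq)} : T ∈ FT Fq N ↔ dg T ≤ N := by simp [FT]

lemma card_fiber_le (s : Finset (Finset (PP Fq))) (k : ℕ) :
    (s.filter (fun T => dg T = k)).card ≤ Fintype.card Fq ^ k := by
  rw [← card_MF (Fq := Fq)]
  apply Finset.card_le_card_of_injOn dT _ dT_injective.injOn
  intro T hT
  have := (Finset.mem_filter.mp hT).2
  rw [Finset.mem_coe, mem_MF]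
  exact ⟨dT_monic T, by rw [natDegree_dT, this]⟩

lemma card_fiberP_le (s : Finset (PP Fq)) (k : ℕ) :
    (s.filter (fun T => T.1.natDegree = k)).card ≤ Fintype.card Fq ^ k := by
  rw [← card_MF (Fq := Fq)]
  apply Finset.card_le_card_of_injOn Subtype.val _ Subtype.val_injective.injOn
  intro T hT
  have := (Finset.mem_filter.mp hT).2
  rw [Finset.mem_coe, mem_MF]
  exact ⟨T.2.1, this⟩

open scoped Classical in
lemma sum_sq_general {N : ℕ} (p : PP Fq → Prop) (Q : Finset (PP Fq) → Prop)
    (hQ : ∀ T, Q T ↔ ∀ P ∈ T, p P) (hN : ∀ T, Q T → dg T ≤ N) :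
    ∑ T ∈ (FT Fq N).filter Q, (-1 : ℝ) ^ T.card = if ∃ P, p P then 0 else 1 := by
  have hfin : {P : PP Fq | p P}.Finite := by
    apply ((FT Fq N).finite_toSet.preimage (f := fun P : PP Fq => ({P} : Finset (PP Fq)))
      (Finset.singleton_injective.injOn)).subset
    intro P hP
    simp only [Set.mem_preimage, Finset.mem_coe, mem_FT]
    apply hN
    rw [hQ]; simpa using hP
  have : (FT Fq N).filter Q = hfin.toFinset.powerset := by
    ext T
    simp only [Finset.mem_filter, mem_FT, Finset.mem_powerset]
    constructor
    · rintro ⟨_, h⟩ P hP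
      rw [Set.Finite.mem_toFinset]
      exact (hQ T).mp h P hP
    · intro h
      have : Q T := by
        rw [hQ]; intro P hP; simpa using h hP
      exact ⟨hN T this, this⟩
  rw [this]
  have h2 := Finset.sum_powerset_neg_one_pow_card (x := hfin.toFinset)
  have h3 : (∑ T ∈ hfin.toFinset.powerset, (-1 : ℝ) ^ T.card)
      = ((∑ T ∈ hfin.toFinset.powerset, (-1 : ℤ) ^ T.card : ℤ) : ℝ) := by push_cast; rfl
  rw [h3, h2]
  have h4 : hfin.toFinset = ∅ ↔ ¬ ∃ P, p P := by
    rw [Set.Finite.toFinset_eq_empty, Set.eq_empty_iff_forall_notMem]; simp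
  by_cases h : ∃ P, p P
  · simp [h4, h]
  · simp [h4, h]

lemma exists_PP_dvd {f : Fq[X]} (hf : f ≠ 0) (hu : ¬ IsUnit f) : ∃ P : PP Fq, P.1 ∣ f := by
  classical
  obtain ⟨g, hg, hd⟩ := WfDvdMonoid.exists_irreducible_factor hu hf
  refine ⟨⟨normalize g, ?_, ?_⟩, ?_⟩
  · exact monic_normalize hg.ne_zero
  · exact (normalize_associated g).symm.irreducible hg
  · exact (normalize_associated g).dvd.trans hd

lemma squarefree_iff_PP {f : Fq[X]} (hf : f ≠ 0) :
    Squarefree f ↔ ¬ ∃ P : PP Fq, P.1 ^ 2 ∣ f := by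
  constructor
  · rintro h ⟨P, hP⟩
    exact P.2.2.not_isUnit (h P.1 (by rwa [← sq]))
  · intro h x hx
    by_contra hu
    have hx0 : x ≠ 0 := by rintro rfl; simp at hx; exact hf hx
    obtain ⟨P, hP⟩ := exists_PP_dvd hx0 hu
    exact h ⟨P, by rw [sq]; exact (mul_dvd_mul hP hP).trans hx⟩

open scoped Classical in
noncomputable def sqf (f : Fq[X]) : ℝ := if Squarefree f then 1 else 0

lemma dg_le_of_sq_dvd {f : Fq[X]} (hf : f ≠ 0) {T : Finset (PP Fq)} (h : dT T ^ 2 ∣ f) :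
    2 * dg T ≤ f.natDegree := by
  have := natDegree_le_of_dvd h hf
  rwa [(dT_monic T).natDegree_pow, natDegree_dT] at this

open scoped Classical in
lemma sqf_eq_sum {f : Fq[X]} (hf : f ≠ 0) {N : ℕ} (hN : f.natDegree ≤ N) :
    sqf f = ∑ T ∈ (FT Fq N).filter (fun T => dT T ^ 2 ∣ f), (-1 : ℝ) ^ T.card := by
  rw [sum_sq_general (fun P => P.1 ^ 2 ∣ f) (fun T => dT T ^ 2 ∣ f) (fun T => dT_sq_dvd_iff T f)
    (fun T hT => by have := dg_le_of_sq_dvd hf hT; omega)]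
  simp only [sqf, squarefree_iff_PP hf, ite_not]

open scoped Classical in
lemma one_eq_sum {f : Fq[X]} (hf : f.Monic) {N : ℕ} (hN : f.natDegree ≤ N) :
    (if f = 1 then 1 else 0) = ∑ T ∈ (FT Fq N).filter (fun T => dT T ∣ f), (-1 : ℝ) ^ T.card := by
  rw [sum_sq_general (fun P => P.1 ∣ f) (fun T => dT T ∣ f) (fun T => dT_dvd_iff T f)
    (fun T hT => by
      have := natDegree_le_of_dvd hT hf.ne_zero
      rw [natDegree_dT] at this; omega)]
  by_cases h : f = 1
  · have : ¬ ∃ P : PP Fq, P.1 ∣ f := by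
      rintro ⟨P, hP⟩
      rw [h] at hP
      exact P.2.2.not_isUnit (isUnit_of_dvd_one hP)
    simp [h] at this ⊢
    simpa using this
  · have : ∃ P : PP Fq, P.1 ∣ f := exists_PP_dvd hf.ne_zero (fun hu => h (hf.eq_one_of_isUnit hu))
    rw [if_neg h, if_pos this]

end HallFF

namespace HallFF

abbrev QQ (Fq : Type) [Fintype Fq] : ℝ := (Fintype.card Fq : ℝ)

lemma summable_fiber {ι : Type*} (deg : ι → ℕ) (c f : ℕ → ℝ) (hf : ∀ k, 0 ≤ f k)
    (hcard : ∀ (s : Finset ι) (k : ℕ), ((s.filter (fun i => deg i = k)).card : ℝ) ≤ c k)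
    (hs : Summable fun k => c k * f k) :
    Summable (fun i => f (deg i)) ∧ ∑' i, f (deg i) ≤ ∑' k, c k * f k := by
  classical
  have hc : ∀ k, 0 ≤ c k := fun k => le_trans (by positivity) (hcard ∅ k)
  have key : ∀ s : Finset ι, ∑ i ∈ s, f (deg i) ≤ ∑' k, c k * f k := by
    intro s
    rw [← Finset.sum_fiberwise_of_maps_to (t := s.image deg) (g := deg)
      (fun i hi => Finset.mem_image_of_mem _ hi)]
    calc _ ≤ ∑ k ∈ s.image deg, c k * f k := by
          apply Finset.sum_le_sum
          intro k _
          rw [Finset.sum_congr rfl (g := fun _ => f k)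
            (fun i hi => by rw [(Finset.mem_filter.mp hi).2])]
          rw [Finset.sum_const, nsmul_eq_mul]
          exact mul_le_mul_of_nonneg_right (hcard s k) (hf k)
      _ ≤ _ := hs.sum_le_tsum _ (fun k _ => mul_nonneg (hc k) (hf k))
  have hsum := summable_of_sum_le (fun i => hf (deg i)) key
  exact ⟨hsum, hsum.tsum_le_of_sum_le key⟩

variable {Fq : Type} [Field Fq] [Fintype Fq]

lemma one_lt_QQ : 1 < QQ Fq := by
  have : 1 < Fintype.card Fq := Fintype.one_lt_card
  exact_mod_cast this

lemma QQ_pos : 0 < QQ Fq := lt_trans one_pos one_lt_QQ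

lemma two_le_QQ : 2 ≤ QQ Fq := by
  have : 1 < Fintype.card Fq := Fintype.one_lt_card
  exact_mod_cast this

noncomputable def mm (Fq : Type) [Field Fq] [Fintype Fq] (k : ℕ) : ℝ :=
  ∑ T ∈ (FT Fq k).filter (fun T => dg T = k), (-1 : ℝ) ^ T.card

lemma sum_FT_complex (n : ℕ) (f : ℕ → ℂ) :
    ∑ T ∈ FT Fq n, (-1 : ℂ) ^ T.card * f (dg T)
      = ∑ k ∈ Finset.range (n + 1), (mm Fq k : ℂ) * f k := by
  rw [← Finset.sum_fiberwise_of_maps_to (t := Finset.range (n+1)) (g := dg)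
      (fun T hT => by rw [mem_FT] at hT; simp; omega)]
  apply Finset.sum_congr rfl
  intro k hk
  have hk : k ≤ n := by simp at hk; omega
  have : (FT Fq n).filter (fun T => dg T = k) = (FT Fq k).filter (fun T => dg T = k) := by
    ext T; simp only [Finset.mem_filter, mem_FT]; omega
  rw [this, mm]
  push_cast
  rw [Finset.sum_mul]
  apply Finset.sum_congr rfl
  intro T hT
  rw [(Finset.mem_filter.mp hT).2]

lemma sum_FT_real (n : ℕ) (f : ℕ → ℝ) :
    ∑ T ∈ FT Fq n, (-1 : ℝ) ^ T.card * f (dg T)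
      = ∑ k ∈ Finset.range (n + 1), mm Fq k * f k := by
  have := sum_FT_complex (Fq := Fq) n (fun k => (f k : ℂ))
  exact_mod_cast this

lemma mm_rec (n : ℕ) : ∑ k ∈ Finset.range (n + 1), mm Fq k * QQ Fq ^ (n - k)
    = if n = 0 then 1 else 0 := by
  classical
  rw [← sum_FT_real n (fun k => QQ Fq ^ (n - k))]
  have h1 : ∑ A ∈ MF Fq n, (if A = 1 then (1 : ℝ) else 0) = if n = 0 then 1 else 0 := by
    rw [Finset.sum_ite_eq']
    have : (1 : Fq[X]) ∈ MF Fq n ↔ n = 0 := by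
      rw [mem_MF]; simp [monic_one, eq_comm]
    simp only [this]
  rw [← h1]
  rw [Finset.sum_congr rfl (fun A hA => one_eq_sum (mem_MF.mp hA).1 (mem_MF.mp hA).2.le)]
  simp only [Finset.sum_filter]
  rw [Finset.sum_comm]
  apply Finset.sum_congr rfl
  intro T hT
  rw [mem_FT] at hT
  have h2 := count_MF (dT T) 0 (dT_monic T) n (by rw [natDegree_dT]; exact hT)
  rw [natDegree_dT] at h2
  simp only [sub_zero] at h2
  rw [← Finset.sum_filter, Finset.sum_const, h2, nsmul_eq_mul]
  push_cast
  ring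

lemma mm_zero : mm Fq 0 = 1 := by simpa using mm_rec (Fq := Fq) 0

lemma mm_succ (n : ℕ) : mm Fq (n + 1) = - QQ Fq * (if n = 0 then 1 else 0) := by
  have h1 := mm_rec (Fq := Fq) (n + 1)
  rw [Finset.sum_range_succ] at h1
  have h2 : ∑ k ∈ Finset.range (n + 1), mm Fq k * QQ Fq ^ (n + 1 - k)
      = QQ Fq * ∑ k ∈ Finset.range (n + 1), mm Fq k * QQ Fq ^ (n - k) := by
    rw [Finset.mul_sum]
    apply Finset.sum_congr rfl
    intro k hk
    have hk : k ≤ n := by simp at hk; omega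
    rw [Nat.sub_add_comm hk, pow_succ]; ring
  rw [h2, mm_rec] at h1
  simp at h1
  split_ifs at h1 ⊢ <;> linarith

lemma sum_mm (n : ℕ) (hn : 1 ≤ n) (f : ℕ → ℂ) :
    ∑ k ∈ Finset.range (n + 1), (mm Fq k : ℂ) * f k = f 0 - QQ Fq * f 1 := by
  obtain ⟨n, rfl⟩ := Nat.exists_eq_add_of_le' hn
  rw [Finset.sum_range_succ', Finset.sum_range_succ', Finset.sum_eq_zero]
  · simp [mm_zero, mm_succ]; ring
  · intro k _
    simp [mm_succ]

lemma sum_mm_real (n : ℕ) (hn : 1 ≤ n) (f : ℕ → ℝ) :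
    ∑ k ∈ Finset.range (n + 1), mm Fq k * f k = f 0 - QQ Fq * f 1 := by
  obtain ⟨n, rfl⟩ := Nat.exists_eq_add_of_le' hn
  rw [Finset.sum_range_succ', Finset.sum_range_succ', Finset.sum_eq_zero]
  · simp [mm_zero, mm_succ]; ring
  · intro k _
    simp [mm_succ]

lemma sum_sqf (n : ℕ) (hn : 2 ≤ n) : ∑ A ∈ MF Fq n, sqf A = QQ Fq ^ n * (1 - 1 / QQ Fq) := by
  classical
  have : ∑ A ∈ MF Fq n, sqf A = ∑ T ∈ FT Fq n, (-1 : ℝ) ^ T.card *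
      (fun k => if 2 * k ≤ n then QQ Fq ^ (n - 2 * k) else 0) (dg T) := by
    rw [Finset.sum_congr rfl (fun A hA => sqf_eq_sum (mem_MF.mp hA).1.ne_zero (mem_MF.mp hA).2.le)]
    simp only [Finset.sum_filter]
    rw [Finset.sum_comm]
    apply Finset.sum_congr rfl
    intro T hT
    rw [mem_FT] at hT
    rw [← Finset.sum_filter, Finset.sum_const, nsmul_eq_mul]
    split_ifs with h
    · have h2 := count_MF (dT T ^ 2) 0 ((dT_monic T).pow 2) n
        (by rw [(dT_monic T).natDegree_pow, natDegree_dT]; exact h)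
      rw [(dT_monic T).natDegree_pow, natDegree_dT] at h2
      simp only [sub_zero] at h2
      rw [h2]; push_cast; ring
    · rw [Finset.filter_false_of_mem]
      · simp
      · intro A hA hd
        rw [mem_MF] at hA
        have := dg_le_of_sq_dvd hA.1.ne_zero hd
        omega
  rw [this, sum_FT_real n (fun k => if 2 * k ≤ n then QQ Fq ^ (n - 2 * k) else 0)]
  rw [sum_mm_real (Fq := Fq) n (by omega) (fun k => if 2 * k ≤ n then QQ Fq ^ (n - 2 * k) else 0)]
  have hq := QQ_pos (Fq := Fq)
  obtain ⟨m, rfl⟩ := Nat.exists_eq_add_of_le hn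
  simp
  field_simp
  ring

lemma tendsto_FT : Filter.Tendsto (FT Fq) Filter.atTop Filter.atTop := by
  apply Filter.tendsto_atTop_finset_of_monotone
  · intro a b hab T hT
    rw [mem_FT] at *; omega
  · intro T; exact ⟨dg T, by rw [mem_FT]⟩

lemma summable_dg {x : ℝ} (hx : 0 ≤ x) (hx1 : QQ Fq * x < 1) :
    Summable (fun T : Finset (PP Fq) => x ^ dg T) := by
  have hq := QQ_pos (Fq := Fq)
  refine (summable_fiber dg (fun k => QQ Fq ^ k) (fun k => x ^ k) (fun k => by positivity)
    (fun s k => by exact_mod_cast card_fiber_le s k) ?_).1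
  simp only [← mul_pow]
  exact summable_geometric_of_lt_one (by positivity) hx1

lemma hasSum_mu {x : ℂ} (hx1 : QQ Fq * ‖x‖ < 1) :
    HasSum (fun T : Finset (PP Fq) => (-1 : ℂ) ^ T.card * x ^ dg T) (1 - QQ Fq * x) := by
  have hs : Summable (fun T : Finset (PP Fq) => (-1 : ℂ) ^ T.card * x ^ dg T) := by
    apply Summable.of_norm
    simpa using summable_dg (Fq := Fq) (norm_nonneg x) hx1
  have h1 := hs.hasSum.comp tendsto_FT
  have h2 : Filter.Tendsto (fun n => ∑ T ∈ FT Fq n, (-1 : ℂ) ^ T.card * x ^ dg T) Filter.atTop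
      (nhds (1 - QQ Fq * x)) := by
    apply tendsto_const_nhds.congr'
    filter_upwards [Filter.eventually_ge_atTop 1] with n hn
    rw [sum_FT_complex n (fun k => x ^ k), sum_mm n hn]; simp
  rw [← tendsto_nhds_unique h1 h2]
  exact hs.hasSum

lemma hasSum_mu_real {x : ℝ} (hx1 : QQ Fq * |x| < 1) :
    HasSum (fun T : Finset (PP Fq) => (-1 : ℝ) ^ T.card * x ^ dg T) (1 - QQ Fq * x) := by
  have := hasSum_mu (Fq := Fq) (x := (x : ℂ)) (by simpa using hx1)
  exact_mod_cast this

end HallFF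

namespace HallFF

variable {Fq : Type} [Field Fq] [Fintype Fq]

noncomputable def yy (Fq : Type) [Fintype Fq] : ℝ := (QQ Fq ^ 2)⁻¹

lemma yy_pos : 0 < yy Fq := by have := QQ_pos (Fq := Fq); unfold yy; positivity
lemma QQ_mul_yy : QQ Fq * yy Fq = (QQ Fq)⁻¹ := by
  have := QQ_pos (Fq := Fq); unfold yy; field_simp

lemma QQ_mul_yy_lt : QQ Fq * yy Fq < 1 := by
  rw [QQ_mul_yy]; exact inv_lt_one_of_one_lt₀ one_lt_QQ

open scoped Classical in
noncomputable def tri (p : Finset (PP Fq) × Finset (PP Fq)) :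
    (Finset (PP Fq) × Finset (PP Fq)) × Finset (PP Fq) :=
  ((p.1 ∩ p.2, p.1 \ p.2), p.2 \ p.1)

open scoped Classical in
lemma tri_inj : Function.Injective (tri (Fq := Fq)) := by
  rintro ⟨S, T⟩ ⟨S', T'⟩ h
  simp only [tri, Prod.mk.injEq] at h
  obtain ⟨⟨h1, h2⟩, h3⟩ := h
  have hS : S = S' := by
    rw [← Finset.sdiff_union_inter S T, ← Finset.sdiff_union_inter S' T', h1, h2]
  have hT : T = T' := by
    rw [← Finset.sdiff_union_inter T S, ← Finset.sdiff_union_inter T' S', h3,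
      Finset.inter_comm T, h1, Finset.inter_comm T']
  rw [hS, hT]

open scoped Classical in
lemma dg_split (S T : Finset (PP Fq)) : dg S = dg (S ∩ T) + dg (S \ T) := by
  have := Finset.sum_inter_add_sum_sdiff S T (fun P : PP Fq => P.1.natDegree)
  exact this.symm

open scoped Classical in
lemma dg_union (S T : Finset (PP Fq)) : dg (S ∪ T) = dg (S ∩ T) + dg (S \ T) + dg (T \ S) := by
  have h1 := dg_union_add_inter S T
  have h2 := dg_split S T
  have h3 := dg_split T S
  rw [Finset.inter_comm T S] at h3
  omega

open scoped Classical in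
lemma summable_pair {r : ℝ} (hr : 0 ≤ r) (hrq : r < QQ Fq) :
    Summable (fun p : Finset (PP Fq) × Finset (PP Fq) =>
      yy Fq ^ dg (p.1 ∪ p.2) * r ^ dg (p.1 ∩ p.2)) := by
  have hy := yy_pos (Fq := Fq)
  have h1 := summable_dg (Fq := Fq) (x := yy Fq * r) (by positivity) (by
    rw [← mul_assoc, QQ_mul_yy]
    rw [inv_mul_lt_one₀ QQ_pos]; exact hrq)
  have h2 := summable_dg (Fq := Fq) (x := yy Fq) (by positivity) QQ_mul_yy_lt
  have h3 := ((h1.mul_of_nonneg h2 (fun _ => by positivity) (fun _ => by positivity)).mul_of_nonneg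
    h2 (fun _ => by positivity) (fun _ => by positivity)).comp_injective (tri_inj (Fq := Fq))
  refine h3.congr ?_
  rintro ⟨S, T⟩
  simp only [Function.comp, tri, dg_union, mul_pow, pow_add]
  ring

lemma card_fiber2_le (s : Finset (Finset (PP Fq) × Finset (PP Fq))) (k : ℕ) :
    (s.filter (fun p => dg p.1 + dg p.2 = k)).card ≤ (k + 1) * Fintype.card Fq ^ k := by
  classical
  have hsub : s.filter (fun p => dg p.1 + dg p.2 = k) ⊆
      (Finset.HasAntidiagonal.antidiagonal k).biUnion (fun a =>
        ((s.image Prod.fst).filter (fun T => dg T = a.1)) ×ˢ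
        ((s.image Prod.snd).filter (fun T => dg T = a.2))) := by
    intro p hp
    rw [Finset.mem_filter] at hp
    rw [Finset.mem_biUnion]
    refine ⟨(dg p.1, dg p.2), by simpa using hp.2, ?_⟩
    simp only [Finset.mem_product, Finset.mem_filter, and_true]
    exact ⟨Finset.mem_image_of_mem _ hp.1, Finset.mem_image_of_mem _ hp.1⟩
  refine (Finset.card_le_card hsub).trans (Finset.card_biUnion_le.trans ?_)
  calc _ ≤ ∑ a ∈ Finset.HasAntidiagonal.antidiagonal k, Fintype.card Fq ^ k := by
        apply Finset.sum_le_sum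
        intro a ha
        rw [Finset.card_product, ← (Finset.HasAntidiagonal.mem_antidiagonal.mp ha), pow_add]
        exact Nat.mul_le_mul (card_fiber_le _ _) (card_fiber_le _ _)
    _ = _ := by simp

open scoped Classical in
noncomputable def tailTerm (z : ℕ) (p : Finset (PP Fq) × Finset (PP Fq)) : ℝ :=
  if z < dg p.1 then yy Fq ^ dg (p.1 ∪ p.2) else 0

lemma tail_bound : ∃ C : ℝ, 0 ≤ C ∧ ∀ z : ℕ, Summable (tailTerm (Fq := Fq) z) ∧
    ∑' p, tailTerm (Fq := Fq) z p ≤ C * ((z + 1) * (QQ Fq)⁻¹ ^ z) := by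
  classical
  have hq := QQ_pos (Fq := Fq)
  have hy := yy_pos (Fq := Fq)
  have hqi : (QQ Fq)⁻¹ < 1 := inv_lt_one_of_one_lt₀ one_lt_QQ
  have hgeo : Summable (fun j : ℕ => ((j : ℝ) + 1) * (QQ Fq)⁻¹ ^ j) := by
    have h1 := summable_pow_mul_geometric_of_norm_lt_one (R := ℝ) 1 (r := (QQ Fq)⁻¹)
      (by rw [Real.norm_of_nonneg (by positivity)]; exact hqi)
    have h2 := summable_geometric_of_lt_one (r := (QQ Fq)⁻¹) (by positivity) hqi
    refine (h1.add h2).congr ?_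
    intro j; simp; ring
  have h2 := summable_dg (Fq := Fq) (x := yy Fq) (by positivity) QQ_mul_yy_lt
  refine ⟨(∑' j : ℕ, ((j : ℝ) + 1) * (QQ Fq)⁻¹ ^ j) * ∑' T : Finset (PP Fq), yy Fq ^ dg T, ?_, ?_⟩
  · exact mul_nonneg (tsum_nonneg fun _ => by positivity) (tsum_nonneg fun _ => by positivity)
  intro z
  have hqy : ∀ k : ℕ, QQ Fq ^ k * yy Fq ^ k = (QQ Fq)⁻¹ ^ k := fun k => by
    rw [← mul_pow, QQ_mul_yy]
  set F : ℕ → ℝ := fun k => (((k : ℝ) + 1) * QQ Fq ^ k) * (if z < k then yy Fq ^ k else 0) with hF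
  have hFle : ∀ k, F k ≤ ((k : ℝ) + 1) * (QQ Fq)⁻¹ ^ k := by
    intro k
    simp only [hF]
    split_ifs
    · rw [mul_assoc, hqy]
    · rw [mul_zero]; positivity
  have hF0 : ∀ k, 0 ≤ F k := by
    intro k; simp only [hF]; split_ifs <;> positivity
  have hFs : Summable F := Summable.of_nonneg_of_le hF0 hFle hgeo
  obtain ⟨hs1, hb1⟩ := summable_fiber (ι := Finset (PP Fq) × Finset (PP Fq))
    (fun p => dg p.1 + dg p.2) (fun k => ((k : ℝ) + 1) * QQ Fq ^ k)
    (fun k => if z < k then yy Fq ^ k else 0) (fun k => by split_ifs <;> positivity)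
    (fun s k => by
      have := card_fiber2_le s k
      calc _ ≤ (((k + 1) * Fintype.card Fq ^ k : ℕ) : ℝ) := by exact_mod_cast this
        _ = _ := by push_cast; rfl) hFs
  have hFb : ∑' k, F k ≤ ((z + 1) * (QQ Fq)⁻¹ ^ z) * ∑' j : ℕ, ((j : ℝ) + 1) * (QQ Fq)⁻¹ ^ j := by
    rw [← hFs.sum_add_tsum_nat_add z, Finset.sum_eq_zero, zero_add, ← tsum_mul_left]
    · apply Summable.tsum_le_tsum _ ((summable_nat_add_iff z).mpr hFs) (hgeo.mul_left _)
      intro j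
      refine (hFle _).trans ?_
      rw [pow_add]
      have : ((j + z : ℕ) : ℝ) + 1 ≤ ((z : ℝ) + 1) * ((j : ℝ) + 1) := by
        push_cast
        have : (0 : ℝ) ≤ (z : ℝ) * j := by positivity
        nlinarith
      calc _ ≤ (((z : ℝ) + 1) * ((j : ℝ) + 1)) * ((QQ Fq)⁻¹ ^ j * (QQ Fq)⁻¹ ^ z) := by gcongr
        _ = _ := by ring
    · intro k hk
      simp at hk
      simp [hF, not_lt.mpr hk.le]
  set g : (Finset (PP Fq) × Finset (PP Fq)) → ℝ :=
    fun p => if z < dg p.1 + dg p.2 then yy Fq ^ (dg p.1 + dg p.2) else 0 with hg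
  have hg0 : ∀ p, 0 ≤ g p := fun p => by simp only [hg]; split_ifs <;> positivity
  have h3 := hs1.mul_of_nonneg h2 hg0 (fun _ => by positivity)
  have heq : ∀ p, tailTerm (Fq := Fq) z p =
      (fun x : (Finset (PP Fq) × Finset (PP Fq)) × Finset (PP Fq) =>
        g x.1 * yy Fq ^ dg x.2) (tri p) := by
    rintro ⟨S, T⟩
    simp only [tailTerm, hg, tri]
    rw [← dg_split]
    split_ifs
    · rw [dg_union, dg_split S T, pow_add]
    · simp
  have hts : Summable (tailTerm (Fq := Fq) z) :=
    (h3.comp_injective (tri_inj (Fq := Fq))).congr (fun p => (heq p).symm)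
  refine ⟨hts, ?_⟩
  calc ∑' p, tailTerm (Fq := Fq) z p ≤ ∑' x : (Finset (PP Fq) × Finset (PP Fq)) × Finset (PP Fq),
        g x.1 * yy Fq ^ dg x.2 := by
        apply Summable.tsum_le_tsum_of_inj tri (tri_inj (Fq := Fq)) _ _ hts h3
        · intro c _; exact mul_nonneg (hg0 _) (by positivity)
        · intro p; exact (heq p).le
    _ = (∑' p, g p) * ∑' T : Finset (PP Fq), yy Fq ^ dg T := by
        rw [tsum_mul_tsum_of_summable_norm]
        · exact hs1.norm
        · exact h2.norm
    _ ≤ (((z + 1) * (QQ Fq)⁻¹ ^ z) * ∑' j : ℕ, ((j : ℝ) + 1) * (QQ Fq)⁻¹ ^ j) *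
        ∑' T : Finset (PP Fq), yy Fq ^ dg T := by
        apply mul_le_mul_of_nonneg_right (hb1.trans hFb) (tsum_nonneg fun _ => by positivity)
    _ = _ := by ring

end HallFF

namespace HallFF

variable {Fq : Type} [Field Fq] [Fintype Fq]

open scoped Classical in
noncomputable def Mz (z : ℕ) (A : Fq[X]) : ℝ :=
  ∑ T ∈ (FT Fq z).filter (fun T => dT T ^ 2 ∣ A), (-1 : ℝ) ^ T.card

open scoped Classical in
noncomputable def tauF (n z : ℕ) (A : Fq[X]) : Finset (Finset (PP Fq)) :=
  (FT Fq n).filter (fun T => dT T ^ 2 ∣ A ∧ z < dg T)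

noncomputable def tau (n z : ℕ) (A : Fq[X]) : ℝ := (tauF n z A).card

lemma sqf_sub_Mz {n z : ℕ} (hz : z ≤ n) {A : Fq[X]} (hA : A ∈ MF Fq n) :
    |sqf A - Mz z A| ≤ tau n z A := by
  classical
  rw [mem_MF] at hA
  rw [sqf_eq_sum hA.1.ne_zero hA.2.le, Mz]
  have hsub : (FT Fq z).filter (fun T => dT T ^ 2 ∣ A) ⊆ (FT Fq n).filter (fun T => dT T ^ 2 ∣ A) := by
    intro T
    simp only [Finset.mem_filter, mem_FT]
    exact fun h => ⟨h.1.trans hz, h.2⟩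
  rw [← Finset.sum_sdiff hsub, add_sub_cancel_right]
  refine (Finset.abs_sum_le_sum_abs _ _).trans ?_
  simp only [abs_pow, abs_neg, abs_one, one_pow, Finset.sum_const, nsmul_eq_mul, mul_one, tau]
  norm_cast
  apply Finset.card_le_card
  intro T
  simp only [Finset.mem_sdiff, Finset.mem_filter, mem_FT, tauF]
  intro h
  refine ⟨h.1.1, h.1.2, ?_⟩
  by_contra h'
  exact h.2 ⟨by omega, h.1.2⟩

lemma tau_nonneg (n z : ℕ) (A : Fq[X]) : 0 ≤ tau n z A := Nat.cast_nonneg _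

lemma tau_le_sq (n z : ℕ) (A : Fq[X]) : tau n z A ≤ tau n z A ^ 2 := by
  unfold tau
  have := Nat.le_self_pow (two_ne_zero) (tauF n z A).card
  exact_mod_cast this

open scoped Classical in
lemma union_sq_dvd (S T : Finset (PP Fq)) (A : Fq[X]) :
    dT (S ∪ T) ^ 2 ∣ A ↔ dT S ^ 2 ∣ A ∧ dT T ^ 2 ∣ A := by
  simp only [dT_sq_dvd_iff, Finset.mem_union]
  constructor
  · intro h; exact ⟨fun P hP => h P (Or.inl hP), fun P hP => h P (Or.inr hP)⟩
  · rintro ⟨h1, h2⟩ P (hP | hP)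
    · exact h1 P hP
    · exact h2 P hP

lemma natDegree_dT_sq (T : Finset (PP Fq)) : (dT T ^ 2).natDegree = 2 * dg T := by
  rw [(dT_monic T).natDegree_pow, natDegree_dT]

lemma Q_pow_sub {n k : ℕ} (h : 2 * k ≤ n) : QQ Fq ^ (n - 2 * k) = QQ Fq ^ n * yy Fq ^ k := by
  have := QQ_pos (Fq := Fq)
  rw [pow_sub₀ _ this.ne' h, yy, inv_pow, pow_mul]

lemma Q_pow_le_one {n k : ℕ} (h : n ≤ 2 * k) : QQ Fq ^ n * yy Fq ^ k ≤ 1 := by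
  have := QQ_pos (Fq := Fq)
  rw [yy, inv_pow, ← pow_mul, ← div_eq_mul_inv, div_le_one (by positivity)]
  exact pow_le_pow_right₀ one_lt_QQ.le h

open scoped Classical in
lemma count_sq_le (n : ℕ) (U : Finset (PP Fq)) :
    (((MF Fq n).filter (fun A => dT U ^ 2 ∣ A)).card : ℝ) ≤ QQ Fq ^ n * yy Fq ^ dg U := by
  have := QQ_pos (Fq := Fq)
  have := yy_pos (Fq := Fq)
  by_cases h : 2 * dg U ≤ n
  · have h2 := count_MF (dT U ^ 2) 0 ((dT_monic U).pow 2) n (by rw [natDegree_dT_sq]; exact h)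
    simp only [sub_zero, natDegree_dT_sq] at h2
    rw [h2, ← Q_pow_sub h]; push_cast; rfl
  · rw [Finset.filter_false_of_mem]
    · simp; positivity
    · intro A hA hd
      rw [mem_MF] at hA
      have := dg_le_of_sq_dvd hA.1.ne_zero hd
      omega

lemma sum_tau_sq (n z : ℕ) (hs : Summable (tailTerm (Fq := Fq) z)) :
    ∑ A ∈ MF Fq n, tau n z A ^ 2 ≤ QQ Fq ^ n * ∑' p, tailTerm (Fq := Fq) z p := by
  classical
  have hq := QQ_pos (Fq := Fq)
  have hy := yy_pos (Fq := Fq)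
  set V := (FT Fq n).filter (fun T => z < dg T) with hV
  have h1 : ∀ A : Fq[X], tau n z A ^ 2 = ∑ p ∈ V ×ˢ V,
      if dT (p.1 ∪ p.2) ^ 2 ∣ A then (1 : ℝ) else 0 := by
    intro A
    have : tauF n z A = V.filter (fun T => dT T ^ 2 ∣ A) := by
      ext T; simp only [tauF, hV, Finset.mem_filter]; tauto
    rw [tau, this, sq, Finset.card_filter]
    push_cast
    rw [Finset.sum_mul_sum, ← Finset.sum_product']
    apply Finset.sum_congr rfl
    intro p _
    rw [ite_zero_mul_ite_zero, mul_one]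
    simp only [union_sq_dvd]
  simp only [h1]
  rw [Finset.sum_comm]
  calc _ ≤ ∑ p ∈ V ×ˢ V, QQ Fq ^ n * tailTerm z p := by
        apply Finset.sum_le_sum
        rintro p hp
        rw [Finset.sum_boole]
        refine (count_sq_le n _).trans ?_
        have : z < dg p.1 := by
          rw [Finset.mem_product] at hp
          exact (Finset.mem_filter.mp hp.1).2
        rw [tailTerm, if_pos this]
    _ = QQ Fq ^ n * ∑ p ∈ V ×ˢ V, tailTerm z p := by rw [Finset.mul_sum]
    _ ≤ _ := by
        apply mul_le_mul_of_nonneg_left _ (by positivity)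
        apply hs.sum_le_tsum
        intro p _
        unfold tailTerm; split_ifs <;> positivity

lemma dT_coprime {S T : Finset (PP Fq)} (h : Disjoint S T) : IsCoprime (dT S) (dT T) := by
  apply IsCoprime.prod_left
  intro P hP
  apply IsCoprime.prod_right
  intro Q hQ
  exact PP_coprime (fun e => Finset.disjoint_left.mp h hP (e ▸ hQ))

open scoped Classical in
lemma dT_split (S T : Finset (PP Fq)) : dT S = dT (S ∩ T) * dT (S \ T) :=
  (Finset.prod_inter_mul_prod_sdiff S T (fun P : PP Fq => P.1)).symm

open scoped Classical in
lemma exists_crt (S T : Finset (PP Fq)) (g : Fq[X]) (h : dT (S ∩ T) ^ 2 ∣ g) :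
    ∃ A0, dT S ^ 2 ∣ A0 ∧ dT T ^ 2 ∣ A0 + g := by
  obtain ⟨g', rfl⟩ := h
  have hc : IsCoprime (dT (S \ T) ^ 2) (dT (T \ S) ^ 2) :=
    (dT_coprime disjoint_sdiff_sdiff).pow
  obtain ⟨u, v, huv⟩ := hc
  refine ⟨- g' * u * (dT (S ∩ T) ^ 2 * dT (S \ T) ^ 2), ?_, ?_⟩
  · rw [dT_split S T, mul_pow]; exact dvd_mul_left _ _
  · rw [dT_split T S, Finset.inter_comm T S, mul_pow]
    refine ⟨g' * v, ?_⟩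
    linear_combination (- g' * dT (S ∩ T) ^ 2) * huv

open scoped Classical in
lemma count_pair (n : ℕ) (S T : Finset (PP Fq)) (g : Fq[X]) :
    |(((MF Fq n).filter (fun A => dT S ^ 2 ∣ A ∧ dT T ^ 2 ∣ A + g)).card : ℝ)
      - (if dT (S ∩ T) ^ 2 ∣ g then QQ Fq ^ n * yy Fq ^ dg (S ∪ T) else 0)| ≤ 1 := by
  have hq := QQ_pos (Fq := Fq)
  have hy := yy_pos (Fq := Fq)
  split_ifs with h
  · obtain ⟨A0, hA1, hA2⟩ := exists_crt S T g h
    have he : (MF Fq n).filter (fun A => dT S ^ 2 ∣ A ∧ dT T ^ 2 ∣ A + g)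
        = (MF Fq n).filter (fun A => dT (S ∪ T) ^ 2 ∣ A - A0) := by
      apply Finset.filter_congr
      intro A _
      rw [union_sq_dvd, dvd_sub_left hA1]
      have : A - A0 = (A + g) - (A0 + g) := by ring
      rw [this, dvd_sub_left hA2]
    rw [he]
    by_cases hn : 2 * dg (S ∪ T) ≤ n
    · have h2 := count_MF (dT (S ∪ T) ^ 2) A0 ((dT_monic _).pow 2) n
        (by rw [natDegree_dT_sq]; exact hn)
      rw [natDegree_dT_sq] at h2
      rw [h2, ← Q_pow_sub hn]; push_cast; simp
    · have h2 := count_MF_le (dT (S ∪ T) ^ 2) A0 n (by rw [natDegree_dT_sq]; omega)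
      have h3 := Q_pow_le_one (Fq := Fq) (n := n) (k := dg (S ∪ T)) (by omega)
      have h4 : (((MF Fq n).filter (fun A => dT (S ∪ T) ^ 2 ∣ A - A0)).card : ℝ) ≤ 1 := by
        exact_mod_cast h2
      have h5 : 0 ≤ QQ Fq ^ n * yy Fq ^ dg (S ∪ T) := by positivity
      have h6 : (0 : ℝ) ≤ ((MF Fq n).filter (fun A => dT (S ∪ T) ^ 2 ∣ A - A0)).card := by positivity
      rw [abs_le]; constructor <;> linarith
  · rw [Finset.filter_false_of_mem]
    · simp
    · rintro A _ ⟨h1, h2⟩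
      apply h
      have h3 : dT (S ∩ T) ^ 2 ∣ dT S ^ 2 := by
        rw [dT_split S T, mul_pow]; exact dvd_mul_right _ _
      have h4 : dT (S ∩ T) ^ 2 ∣ dT T ^ 2 := by
        rw [dT_split T S, mul_pow, Finset.inter_comm T S]; exact dvd_mul_right _ _
      exact (dvd_add_right (h3.trans h1)).mp (h4.trans h2)

lemma card_FT_le (z : ℕ) : ((FT Fq z).card : ℝ) ≤ 2 * QQ Fq ^ z := by
  classical
  have h2 := two_le_QQ (Fq := Fq)
  induction z with
  | zero =>
    have : FT Fq 0 = {∅} := by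
      ext T; simp [mem_FT, dg_eq_zero]
    rw [this]; simp
  | succ z ih =>
    have : FT Fq (z+1) ⊆ FT Fq z ∪ (FT Fq (z+1)).filter (fun T => dg T = z + 1) := by
      intro T; simp only [Finset.mem_union, Finset.mem_filter, mem_FT]; omega
    have h3 := (Finset.card_le_card this).trans (Finset.card_union_le _ _)
    have h4 := card_fiber_le (FT Fq (z+1)) (z+1)
    have h5 : ((FT Fq (z+1)).card : ℝ) ≤ (FT Fq z).card + QQ Fq ^ (z+1) := by
      exact_mod_cast h3.trans (Nat.add_le_add_left h4 _)
    have h6 : 2 * QQ Fq ^ z ≤ QQ Fq ^ (z + 1) := by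
      rw [pow_succ, mul_comm]; gcongr
    linarith

open scoped Classical in
noncomputable def sT (g : Fq[X]) (p : Finset (PP Fq) × Finset (PP Fq)) : ℝ :=
  (-1) ^ p.1.card * (-1) ^ p.2.card *
    (if dT (p.1 ∩ p.2) ^ 2 ∣ g then yy Fq ^ dg (p.1 ∪ p.2) else 0)

lemma main_corr (n z : ℕ) (g : Fq[X]) :
    |∑ A ∈ MF Fq n, Mz z A * Mz z (A + g) - QQ Fq ^ n * ∑ p ∈ FT Fq z ×ˢ FT Fq z, sT g p|
      ≤ 4 * QQ Fq ^ (2 * z) := by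
  classical
  have h1 : ∀ A : Fq[X], Mz z A * Mz z (A + g) = ∑ p ∈ FT Fq z ×ˢ FT Fq z,
      (-1 : ℝ) ^ p.1.card * (-1) ^ p.2.card *
        if dT p.1 ^ 2 ∣ A ∧ dT p.2 ^ 2 ∣ A + g then (1 : ℝ) else 0 := by
    intro A
    simp only [Mz, Finset.sum_filter]
    rw [Finset.sum_mul_sum, ← Finset.sum_product']
    apply Finset.sum_congr rfl
    intro p _
    by_cases h1 : dT p.1 ^ 2 ∣ A <;> by_cases h2 : dT p.2 ^ 2 ∣ A + g <;> simp [h1, h2]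
  simp only [h1]
  rw [Finset.sum_comm, Finset.mul_sum, ← Finset.sum_sub_distrib]
  refine (Finset.abs_sum_le_sum_abs _ _).trans ?_
  calc _ ≤ ∑ p ∈ FT Fq z ×ˢ FT Fq z, (1 : ℝ) := by
        apply Finset.sum_le_sum
        intro p _
        rw [← Finset.mul_sum, Finset.sum_boole, sT]
        have := count_pair n p.1 p.2 g
        have e : ∀ a b c : ℝ, a * c - QQ Fq ^ n * (a * b) = a * (c - QQ Fq ^ n * b) := by
          intros; ring
        rw [e, abs_mul, abs_mul, abs_pow, abs_pow]
        simp only [abs_neg, abs_one, one_pow, one_mul]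
        rwa [mul_ite, mul_zero]
    _ = ((FT Fq z).card : ℝ) ^ 2 := by simp [sq]
    _ ≤ (2 * QQ Fq ^ z) ^ 2 := by gcongr; exact card_FT_le z
    _ = _ := by ring

lemma abs_sT_le (g : Fq[X]) (p : Finset (PP Fq) × Finset (PP Fq)) :
    |sT g p| ≤ (open scoped Classical in yy Fq ^ dg (p.1 ∪ p.2)) := by
  have hy := yy_pos (Fq := Fq)
  rw [sT, abs_mul, abs_mul, abs_pow, abs_pow]
  simp only [abs_neg, abs_one, one_pow, one_mul]
  split_ifs
  · rw [abs_of_nonneg (by positivity)]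
  · simp; positivity

lemma summable_yy : Summable (fun p : Finset (PP Fq) × Finset (PP Fq) =>
    (open scoped Classical in yy Fq ^ dg (p.1 ∪ p.2))) := by
  have := summable_pair (Fq := Fq) (r := 1) zero_le_one one_lt_QQ
  simpa using this

lemma summable_sT (g : Fq[X]) : Summable (sT g) :=
  Summable.of_norm_bounded summable_yy (fun p => abs_sT_le g p)

lemma abs_sum_sub_tsum_le {ι : Type*} (f t : ι → ℝ) (s : Finset ι) (hf : Summable f)
    (ht : Summable t) (h0 : ∀ i, 0 ≤ t i) (h : ∀ i, i ∉ s → |f i| ≤ t i) :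
    |∑ i ∈ s, f i - ∑' i, f i| ≤ ∑' i, t i := by
  rw [← hf.sum_add_tsum_compl (s := s), sub_add_cancel_left, abs_neg]
  have h1 : |∑' p : ↥((↑s : Set ι)ᶜ), f p| ≤ ∑' p : ↥((↑s : Set ι)ᶜ), t p := by
    rw [← Real.norm_eq_abs]
    apply tsum_of_norm_bounded (ht.subtype _).hasSum
    rintro ⟨p, hp⟩
    exact h p (by simpa using hp)
  exact h1.trans (Summable.tsum_subtype_le _ _ h0 ht)

lemma tail_sT (z : ℕ) (g : Fq[X]) (hs : Summable (tailTerm (Fq := Fq) z)) :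
    |∑ p ∈ FT Fq z ×ˢ FT Fq z, sT g p - ∑' p, sT g p| ≤ 2 * ∑' p, tailTerm (Fq := Fq) z p := by
  classical
  have hy := yy_pos (Fq := Fq)
  have hs' : Summable (fun p => tailTerm (Fq := Fq) z (Prod.swap p)) :=
    hs.comp_injective Prod.swap_injective
  have ht0 : ∀ p, 0 ≤ tailTerm (Fq := Fq) z p := fun p => by
    unfold tailTerm; split_ifs <;> positivity
  have he : ∑' p, tailTerm (Fq := Fq) z (Prod.swap p) = ∑' p, tailTerm (Fq := Fq) z p :=
    (Equiv.prodComm (Finset (PP Fq)) (Finset (PP Fq))).tsum_eq (tailTerm (Fq := Fq) z)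
  have key := abs_sum_sub_tsum_le (sT g)
    (fun p => tailTerm (Fq := Fq) z p + tailTerm (Fq := Fq) z (Prod.swap p))
    (FT Fq z ×ˢ FT Fq z) (summable_sT g) (hs.add hs') (fun p => add_nonneg (ht0 _) (ht0 _)) ?_
  · rw [hs.tsum_add hs', he, ← two_mul] at key
    exact key
  · rintro ⟨S, T⟩ hp
    have hp : ¬ (dg S ≤ z ∧ dg T ≤ z) := by
      intro h; apply hp; rw [Finset.mem_product, mem_FT, mem_FT]; exact h
    refine (abs_sT_le g _).trans ?_
    have hu : dg (T ∪ S) = dg (S ∪ T) := by rw [Finset.union_comm]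
    have h0 : 0 ≤ yy Fq ^ dg (S ∪ T) := by positivity
    by_cases hS : z < dg S
    · have : tailTerm z (S, T) = yy Fq ^ dg (S ∪ T) := by
        simp only [tailTerm, if_pos hS]
      have h1 := ht0 (Prod.swap (S, T))
      rw [this]
      linarith
    · have hT : z < dg T := by omega
      have : tailTerm z (Prod.swap (S, T)) = yy Fq ^ dg (S ∪ T) := by
        simp only [tailTerm, Prod.swap, if_pos hT, hu]
      have h1 := ht0 (S, T)
      rw [this]
      linarith

lemma sum_shift {n m : ℕ} (hmn : m ≤ n) {g : Fq[X]} (hg : g ∈ GF Fq m) (f : Fq[X] → ℝ) :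
    ∑ A ∈ MF Fq n, f (A + g) = ∑ A ∈ MF Fq n, f A := by
  have hg' : -g ∈ GF Fq m := by rw [mem_GF] at *; rwa [degree_neg]
  apply Finset.sum_bij' (fun A _ => A + g) (fun A _ => A - g)
  · intro A hA; exact add_mem_MF hmn hA hg
  · intro A hA; rw [sub_eq_add_neg]; exact add_mem_MF hmn hA hg'
  · intros; ring
  · intros; ring
  · intros; rfl

lemma corr_bound1 {n m z : ℕ} (hmn : m ≤ n) (hz : z ≤ n) {g : Fq[X]} (hg : g ∈ GF Fq m)
    (hs : Summable (tailTerm (Fq := Fq) z)) :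
    |∑ A ∈ MF Fq n, sqf A * sqf (A + g) - QQ Fq ^ n * ∑' p, sT g p|
      ≤ 5 * (QQ Fq ^ n * ∑' p, tailTerm (Fq := Fq) z p) + 4 * QQ Fq ^ (2 * z) := by
  have hq := QQ_pos (Fq := Fq)
  have h1 : |∑ A ∈ MF Fq n, sqf A * sqf (A + g) - ∑ A ∈ MF Fq n, Mz z A * Mz z (A + g)|
      ≤ 3 * (QQ Fq ^ n * ∑' p, tailTerm (Fq := Fq) z p) := by
    rw [← Finset.sum_sub_distrib]
    refine (Finset.abs_sum_le_sum_abs _ _).trans ?_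
    calc _ ≤ ∑ A ∈ MF Fq n, (3 / 2 * tau n z A ^ 2 + 3 / 2 * tau n z (A + g) ^ 2) := by
          apply Finset.sum_le_sum
          intro A hA
          have a1 := sqf_sub_Mz hz hA
          have a2 := sqf_sub_Mz hz (add_mem_MF hmn hA hg)
          have b1 := tau_le_sq n z A
          have b2 := tau_le_sq n z (A + g)
          have c1 := tau_nonneg n z A
          have c2 := tau_nonneg n z (A + g)
          have d : ∀ f : Fq[X], |sqf f| ≤ 1 := by
            intro f; unfold sqf; split_ifs <;> simp
          have e : sqf A * sqf (A + g) - Mz z A * Mz z (A + g)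
              = sqf A * (sqf (A + g) - Mz z (A + g)) + (sqf A - Mz z A) * sqf (A + g)
                - (sqf A - Mz z A) * (sqf (A + g) - Mz z (A + g)) := by ring
          rw [e]
          refine (abs_sub _ _).trans ?_
          refine (add_le_add_left (abs_add_le _ _) _).trans ?_
          rw [abs_mul, abs_mul, abs_mul]
          have f1 : |sqf A| * |sqf (A + g) - Mz z (A + g)| ≤ 1 * tau n z (A + g) :=
            mul_le_mul (d _) a2 (abs_nonneg _) zero_le_one
          have f2 : |sqf A - Mz z A| * |sqf (A + g)| ≤ tau n z A * 1 :=
            mul_le_mul a1 (d _) (abs_nonneg _) c1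
          have f3 : |sqf A - Mz z A| * |sqf (A + g) - Mz z (A + g)| ≤ tau n z A * tau n z (A + g) :=
            mul_le_mul a1 a2 (abs_nonneg _) c1
          nlinarith [sq_nonneg (tau n z A - tau n z (A + g))]
      _ = 3 * ∑ A ∈ MF Fq n, tau n z A ^ 2 := by
          rw [Finset.sum_add_distrib, ← Finset.mul_sum, ← Finset.mul_sum,
            sum_shift hmn hg (fun A => tau n z A ^ 2)]
          ring
      _ ≤ _ := by
          apply mul_le_mul_of_nonneg_left (sum_tau_sq n z hs) (by norm_num)
  have h2 := main_corr n z g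
  have h3 := tail_sT z g hs
  have h4 : |QQ Fq ^ n * ∑ p ∈ FT Fq z ×ˢ FT Fq z, sT g p - QQ Fq ^ n * ∑' p, sT g p|
      ≤ 2 * (QQ Fq ^ n * ∑' p, tailTerm (Fq := Fq) z p) := by
    rw [← mul_sub, abs_mul, abs_of_pos (by positivity)]
    calc _ ≤ QQ Fq ^ n * (2 * ∑' p, tailTerm (Fq := Fq) z p) := by gcongr
      _ = _ := by ring
  rw [abs_le] at *
  constructor <;> linarith [h1.1, h1.2, h2.1, h2.2, h4.1, h4.2]

lemma corr_bound : ∃ K : ℝ, 0 ≤ K ∧ ∀ n m : ℕ, 2 ≤ n → m ≤ n → ∀ g ∈ GF Fq m,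
    |∑ A ∈ MF Fq n, sqf A * sqf (A + g) - QQ Fq ^ n * ∑' p, sT g p|
      ≤ QQ Fq ^ n * (K * (n * QQ Fq ^ (-(n : ℝ) / 3))) := by
  obtain ⟨C, hC, hCb⟩ := tail_bound (Fq := Fq)
  have hq := QQ_pos (Fq := Fq)
  have hq1 := one_lt_QQ (Fq := Fq)
  refine ⟨5 * C * QQ Fq + 4, by positivity, ?_⟩
  intro n m hn hmn g hg
  obtain ⟨hs, hb⟩ := hCb (n / 3)
  refine (corr_bound1 hmn (Nat.div_le_self n 3) hg hs).trans ?_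
  have hz1 : ((n / 3 : ℕ) : ℝ) ≤ (n : ℝ) / 3 := Nat.cast_div_le
  have hz2 : (n : ℝ) / 3 < ((n / 3 : ℕ) : ℝ) + 1 := by
    have : n < 3 * (n / 3 + 1) := by omega
    have : (n : ℝ) < 3 * (((n / 3 : ℕ) : ℝ) + 1) := by exact_mod_cast this
    linarith
  have hz3 : ((n / 3 : ℕ) : ℝ) + 1 ≤ n := by
    have : n / 3 + 1 ≤ n := by omega
    exact_mod_cast this
  have e1 : (QQ Fq)⁻¹ ^ (n / 3) ≤ QQ Fq * QQ Fq ^ (-(n : ℝ) / 3) := by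
    rw [inv_pow, ← Real.rpow_natCast, ← Real.rpow_neg hq.le]
    nth_rewrite 2 [← Real.rpow_one (QQ Fq)]
    rw [← Real.rpow_add hq]
    apply Real.rpow_le_rpow_of_exponent_le hq1.le
    linarith
  have e2 : QQ Fq ^ (2 * (n / 3)) ≤ QQ Fq ^ n * QQ Fq ^ (-(n : ℝ) / 3) := by
    rw [← Real.rpow_natCast, ← Real.rpow_natCast, ← Real.rpow_add hq]
    apply Real.rpow_le_rpow_of_exponent_le hq1.le
    push_cast
    linarith
  have hp : 0 < QQ Fq ^ (-(n : ℝ) / 3) := Real.rpow_pos_of_pos hq _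
  have hn1 : (1 : ℝ) ≤ n := by exact_mod_cast (by omega : 1 ≤ n)
  have e3 : ∑' p, tailTerm (Fq := Fq) (n / 3) p ≤ C * (n * (QQ Fq * QQ Fq ^ (-(n : ℝ) / 3))) := by
    refine hb.trans ?_
    gcongr
  have e4 : QQ Fq ^ n * QQ Fq ^ (-(n : ℝ) / 3) ≤ QQ Fq ^ n * (n * QQ Fq ^ (-(n : ℝ) / 3)) := by
    apply mul_le_mul_of_nonneg_left _ (by positivity)
    exact le_mul_of_one_le_left hp.le hn1
  have e5 := mul_le_mul_of_nonneg_left e3 (show 0 ≤ QQ Fq ^ n by positivity)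
  nlinarith [e5, e4, e2]

end HallFF

namespace HallFF

variable {Fq : Type} [Field Fq] [Fintype Fq]

lemma mem_GF_succ {h : ℕ} {f : Fq[X]} : f ∈ GF Fq (h + 1) ↔ f.degree ≤ (h : WithBot ℕ) := by
  rw [mem_GF, degree_lt_iff_coeff_zero, degree_le_iff_coeff_zero]
  constructor
  · intro H m hm
    exact H m (by have : h < m := by exact_mod_cast hm
                  omega)
  · intro H m hm
    exact H m (by have : h < m := by omega
                  exact_mod_cast this)

lemma Nsqfree_eq (A : Fq[X]) (h : ℕ) : Nsqfree A h = ∑ g ∈ GF Fq (h + 1), sqf (A + g) := by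
  classical
  have hset : {f : Fq[X] | (f - A).degree ≤ (h : WithBot ℕ)}
      = ↑((GF Fq (h+1)).image (fun g => A + g)) := by
    ext f
    simp only [Set.mem_setOf_eq, Finset.coe_image, Set.mem_image, Finset.mem_coe, mem_GF_succ]
    constructor
    · intro hf; exact ⟨f - A, hf, by ring⟩
    · rintro ⟨g, hg, rfl⟩; simpa using hg
  rw [Nsqfree, hset, finsum_mem_coe_finset, Finset.sum_image (fun a _ b _ hab => add_left_cancel hab)]
  rfl

lemma var_eq1 (n h : ℕ) : varNsqfreeHall Fq n h = (1 / QQ Fq ^ n) *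
    ∑ A ∈ MF Fq n, (∑ g ∈ GF Fq (h + 1), sqf (A + g) - QQ Fq ^ (h + 1) * (1 - 1 / QQ Fq)) ^ 2 := by
  have hset : {A : Fq[X] | A.Monic ∧ A.natDegree = n} = ↑(MF Fq n) := by
    ext f; simp [mem_MF]
  rw [varNsqfreeHall, hset, finsum_mem_coe_finset]
  simp only [Nsqfree_eq]

lemma sum_GF_shift {m : ℕ} {g : Fq[X]} (hg : g ∈ GF Fq m) (f : Fq[X] → ℝ) :
    ∑ A ∈ GF Fq m, f (A - g) = ∑ A ∈ GF Fq m, f A := by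
  rw [mem_GF, ← mem_degreeLT] at hg
  apply Finset.sum_bij' (fun A _ => A - g) (fun A _ => A + g)
  · intro A hA; rw [mem_GF, ← mem_degreeLT] at *; exact Submodule.sub_mem _ hA hg
  · intro A hA; rw [mem_GF, ← mem_degreeLT] at *; exact Submodule.add_mem _ hA hg
  · intros; ring
  · intros; ring
  · intros; rfl

lemma sum_N_sq {n m : ℕ} (hm : m ≤ n) : ∑ A ∈ MF Fq n, (∑ g ∈ GF Fq m, sqf (A + g)) ^ 2
    = QQ Fq ^ m * ∑ g ∈ GF Fq m, ∑ A ∈ MF Fq n, sqf A * sqf (A + g) := by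
  have h1 : ∀ g1 ∈ GF Fq m, ∑ g2 ∈ GF Fq m, ∑ A ∈ MF Fq n, sqf (A + g1) * sqf (A + g2)
      = ∑ g ∈ GF Fq m, ∑ A ∈ MF Fq n, sqf A * sqf (A + g) := by
    intro g1 hg1
    rw [← sum_GF_shift hg1 (fun g => ∑ A ∈ MF Fq n, sqf A * sqf (A + g))]
    apply Finset.sum_congr rfl
    intro g2 _
    rw [← sum_shift hm hg1 (fun A => sqf A * sqf (A + (g2 - g1)))]
    apply Finset.sum_congr rfl
    intro A _
    congr 2; ring
  simp only [sq, Finset.sum_mul_sum]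
  rw [Finset.sum_comm]
  have : ∀ g1 ∈ GF Fq m, ∑ A ∈ MF Fq n, ∑ g2 ∈ GF Fq m, sqf (A + g1) * sqf (A + g2)
      = ∑ g ∈ GF Fq m, ∑ A ∈ MF Fq n, sqf A * sqf (A + g) := by
    intro g1 hg1
    rw [Finset.sum_comm, h1 g1 hg1]
  rw [Finset.sum_congr rfl this, Finset.sum_const, card_GF, nsmul_eq_mul]
  push_cast; rfl

lemma sum_N {n m : ℕ} (hn : 2 ≤ n) (hm : m ≤ n) :
    ∑ A ∈ MF Fq n, ∑ g ∈ GF Fq m, sqf (A + g) = QQ Fq ^ n * (QQ Fq ^ m * (1 - 1 / QQ Fq)) := by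
  rw [Finset.sum_comm, Finset.sum_congr rfl (fun g hg => by rw [sum_shift hm hg sqf, sum_sqf n hn]),
    Finset.sum_const, card_GF, nsmul_eq_mul]
  push_cast; ring

lemma var_eq2 {n h : ℕ} (hn : 2 ≤ n) (hh : h + 2 ≤ n) : varNsqfreeHall Fq n h =
    (1 / QQ Fq ^ n) * (QQ Fq ^ (h+1) * ∑ g ∈ GF Fq (h+1), ∑ A ∈ MF Fq n, sqf A * sqf (A + g))
      - (QQ Fq ^ (h + 1) * (1 - 1 / QQ Fq)) ^ 2 := by
  have hq := QQ_pos (Fq := Fq)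
  rw [var_eq1]
  simp only [sub_sq]
  rw [Finset.sum_add_distrib, Finset.sum_sub_distrib, ← Finset.sum_mul, ← Finset.mul_sum,
    sum_N hn (by omega), sum_N_sq (by omega), Finset.sum_const, card_MF, nsmul_eq_mul]
  push_cast
  field_simp
  ring

noncomputable def psi (Fq : Type) [Fintype Fq] (h k : ℕ) : ℝ :=
  if 2 * k ≤ h + 1 then 0 else 1 - QQ Fq ^ (h + 1) * yy Fq ^ k

noncomputable def eps (p : Finset (PP Fq) × Finset (PP Fq)) : ℝ :=
  (-1) ^ p.1.card * (-1) ^ p.2.card * (open scoped Classical in yy Fq ^ dg (p.1 ∪ p.2))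

noncomputable def gd (p : Finset (PP Fq) × Finset (PP Fq)) : ℕ :=
  open scoped Classical in dg (p.1 ∩ p.2)

lemma abs_eps (p : Finset (PP Fq) × Finset (PP Fq)) :
    |eps p| = (open scoped Classical in yy Fq ^ dg (p.1 ∪ p.2)) := by
  have hy := yy_pos (Fq := Fq)
  rw [eps, abs_mul, abs_mul, abs_pow, abs_pow, abs_neg, abs_one, one_pow, one_pow, one_mul, one_mul,
    abs_of_nonneg (by positivity)]

lemma sum_sT (h : ℕ) (p : Finset (PP Fq) × Finset (PP Fq)) :
    ∑ g ∈ GF Fq (h+1), sT g p = eps p * psi Fq h (gd p) +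
      QQ Fq ^ (h+1) * (eps p * yy Fq ^ gd p) := by
  classical
  have e1 : ∑ g ∈ GF Fq (h+1), sT g p = eps p *
      (((GF Fq (h+1)).filter (fun g => dT (p.1 ∩ p.2) ^ 2 ∣ g)).card : ℝ) := by
    rw [Finset.card_filter]
    push_cast
    rw [Finset.mul_sum]
    apply Finset.sum_congr rfl
    intro g _
    rw [sT, eps]
    split_ifs <;> simp
  rw [e1]
  have hd : gd p = dg (p.1 ∩ p.2) := rfl
  unfold psi
  split_ifs with hk
  · rw [count_GF _ ((dT_monic _).pow 2) _ (by rw [natDegree_dT_sq, ← hd]; exact hk)]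
    rw [natDegree_dT_sq, ← hd]
    push_cast
    rw [Q_pow_sub hk]; ring
  · rw [count_GF_one _ _ (by rw [natDegree_dT_sq, ← hd]; omega)]
    push_cast; ring

lemma eps_mul (p : Finset (PP Fq) × Finset (PP Fq)) : eps p * yy Fq ^ gd p
      = (-1 : ℝ) ^ p.1.card * yy Fq ^ dg p.1 * ((-1) ^ p.2.card * yy Fq ^ dg p.2) := by
  have h4 : (open scoped Classical in yy Fq ^ dg (p.1 ∪ p.2) * yy Fq ^ dg (p.1 ∩ p.2)) = yy Fq ^ dg p.1 * yy Fq ^ dg p.2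
         := by
    rw [← pow_add, ← pow_add]
    congr 1
    classical
    exact dg_union_add_inter p.1 p.2
  rw [show (-1 : ℝ) ^ p.1.card * yy Fq ^ dg p.1 * ((-1) ^ p.2.card * yy Fq ^ dg p.2)
      = (-1) ^ p.1.card * (-1) ^ p.2.card * (yy Fq ^ dg p.1 * yy Fq ^ dg p.2) by ring, ← h4,
      eps, gd]
  rw [mul_assoc]

lemma hasSum_yy : HasSum (fun T : Finset (PP Fq) => (-1 : ℝ) ^ T.card * yy Fq ^ dg T)
    (1 - 1 / QQ Fq) := by
  have h1 := hasSum_mu_real (Fq := Fq) (x := yy Fq) (by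
    rw [abs_of_pos yy_pos]; exact QQ_mul_yy_lt)
  have h2 : 1 / QQ Fq = QQ Fq * yy Fq := by rw [QQ_mul_yy, one_div]
  rw [h2]
  exact h1

lemma summable_norm_yy :
    Summable (fun T : Finset (PP Fq) => ‖(-1 : ℝ) ^ T.card * yy Fq ^ dg T‖) := by
  have hy := yy_pos (Fq := Fq)
  refine (summable_dg (Fq := Fq) hy.le QQ_mul_yy_lt).congr (fun T => ?_)
  rw [norm_mul, norm_pow, norm_pow, Real.norm_of_nonneg hy.le]
  simp

lemma hasSum_prod : HasSum (fun p : Finset (PP Fq) × Finset (PP Fq) => eps p * yy Fq ^ gd p)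
    ((1 - 1 / QQ Fq) ^ 2) := by
  have key : ∀ f : Finset (PP Fq) → ℝ, ∀ a, HasSum f a → Summable (fun T => ‖f T‖) →
      HasSum (fun p : Finset (PP Fq) × Finset (PP Fq) => f p.1 * f p.2) (a ^ 2) := by
    intro f a h1 h2
    rw [sq]
    exact h1.mul h1 (summable_mul_of_summable_norm h2 h2)
  have h2 := key _ _ hasSum_yy summable_norm_yy
  have h3 := funext (eps_mul (Fq := Fq))
  rw [h3]
  exact h2

noncomputable def ww (Fq : Type) [Field Fq] [Fintype Fq] (k : ℕ) : ℝ :=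
  ∑' p : (gd (Fq := Fq)) ⁻¹' {k}, eps p.1

lemma psi_bound (h k : ℕ) : |psi Fq h k| ≤ 1 := by
  have hq := QQ_pos (Fq := Fq)
  have hy := yy_pos (Fq := Fq)
  unfold psi
  split_ifs with hk
  · simp
  · have := Q_pow_le_one (Fq := Fq) (n := h+1) (k := k) (by omega)
    have h2 : 0 < QQ Fq ^ (h + 1) * yy Fq ^ k := by positivity
    rw [abs_le]; constructor <;> linarith

lemma summable_eps : Summable (eps (Fq := Fq)) :=
  Summable.of_norm_bounded summable_yy (fun p => by rw [Real.norm_eq_abs, abs_eps])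

lemma fiber_sum {φ : ℕ → ℝ} (hs : Summable (fun p => eps (Fq := Fq) p * φ (gd p))) :
    HasSum (fun k => ww Fq k * φ k) (∑' p, eps (Fq := Fq) p * φ (gd p)) := by
  have := hs.hasSum.tsum_fiberwise (gd (Fq := Fq))
  refine (congrArg (fun f => HasSum f _) (funext fun k => ?_)).mp this
  unfold ww
  rw [← tsum_mul_right]
  refine tsum_congr (fun b => ?_)
  have hb : gd b.1 = k := b.2
  rw [hb]

lemma fiber_sum_c {φ : ℕ → ℂ} (hs : Summable (fun p => (eps (Fq := Fq) p : ℂ) * φ (gd p))) :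
    HasSum (fun k => (ww Fq k : ℂ) * φ k) (∑' p, (eps (Fq := Fq) p : ℂ) * φ (gd p)) := by
  have := hs.hasSum.tsum_fiberwise (gd (Fq := Fq))
  refine (congrArg (fun f => HasSum f _) (funext fun k => ?_)).mp this
  unfold ww
  rw [Complex.ofReal_tsum, ← tsum_mul_right]
  refine tsum_congr (fun b => ?_)
  have hb : gd b.1 = k := b.2
  rw [hb]

lemma var_main : ∃ K : ℝ, 0 ≤ K ∧ ∀ n h : ℕ, 2 ≤ n → h + 2 ≤ n →
    |varNsqfreeHall Fq n h - QQ Fq ^ (h+1) * ∑' k, ww Fq k * psi Fq h k|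
      ≤ K * ((QQ Fq ^ (h+1)) ^ 2 * n * QQ Fq ^ (-(n : ℝ) / 3)) := by
  obtain ⟨K, hK, hb⟩ := corr_bound (Fq := Fq)
  have hq := QQ_pos (Fq := Fq)
  refine ⟨K, hK, ?_⟩
  intro n h hn hh
  have hs : Summable (fun p => eps (Fq := Fq) p * psi Fq h (gd p)) :=
    Summable.of_norm_bounded summable_yy (fun p => by
      rw [Real.norm_eq_abs, abs_mul, abs_eps]
      exact mul_le_of_le_one_right (by have := yy_pos (Fq := Fq); positivity) (psi_bound _ _))
  have e1 : ∑ g ∈ GF Fq (h+1), ∑' p, sT g p = (∑' k, ww Fq k * psi Fq h k)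
      + QQ Fq ^ (h+1) * (1 - 1 / QQ Fq) ^ 2 := by
    rw [← Summable.tsum_finsetSum (fun g _ => summable_sT g)]
    simp only [sum_sT]
    rw [hs.tsum_add (hasSum_prod.summable.mul_left _), tsum_mul_left, hasSum_prod.tsum_eq,
      (fiber_sum hs).tsum_eq]
  have e2 : varNsqfreeHall Fq n h - QQ Fq ^ (h+1) * ∑' k, ww Fq k * psi Fq h k
      = (1 / QQ Fq ^ n) * (QQ Fq ^ (h+1) * ∑ g ∈ GF Fq (h+1),
        (∑ A ∈ MF Fq n, sqf A * sqf (A + g) - QQ Fq ^ n * ∑' p, sT g p)) := by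
    rw [var_eq2 hn hh, Finset.sum_sub_distrib, ← Finset.mul_sum, e1]
    field_simp
    ring
  rw [e2, abs_mul, abs_mul, abs_of_pos (by positivity), abs_of_pos (by positivity)]
  have e3 : |∑ g ∈ GF Fq (h+1),
        (∑ A ∈ MF Fq n, sqf A * sqf (A + g) - QQ Fq ^ n * ∑' p, sT g p)|
      ≤ QQ Fq ^ (h+1) * (QQ Fq ^ n * (K * (n * QQ Fq ^ (-(n : ℝ) / 3)))) := by
    refine (Finset.abs_sum_le_sum_abs _ _).trans ?_
    refine (Finset.sum_le_sum (fun g hg => hb n (h+1) hn (by omega) g hg)).trans ?_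
    rw [Finset.sum_const, card_GF, nsmul_eq_mul]
    push_cast; rfl
  calc _ ≤ (1 / QQ Fq ^ n) * (QQ Fq ^ (h+1) *
        (QQ Fq ^ (h+1) * (QQ Fq ^ n * (K * (n * QQ Fq ^ (-(n : ℝ) / 3)))))) := by gcongr
    _ = _ := by field_simp

end HallFF

namespace HallFF

variable {Fq : Type} [Field Fq] [Fintype Fq]

lemma coeff_bound {G : ℂ → ℂ} {c : ℕ → ℂ} {q R r : ℝ} (hq : 0 < q)
    (hc : ∀ u : ℂ, ‖u‖ < q → HasSum (fun k => c k * u ^ k) (G u))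
    (hG : DifferentiableOn ℂ G (Metric.ball 0 R)) (hr : 0 < r) (hrR : r < R) :
    ∃ C > 0, ∀ k, ‖c k‖ ≤ C / r ^ k := by
  obtain ⟨r', hr1, hr2⟩ := exists_between hrR
  have h0 : 0 < r' := hr.trans hr1
  lift r' to NNReal using h0.le
  lift r to NNReal using hr.le
  have hp := (hG.mono (Metric.closedBall_subset_ball hr2)).hasFPowerSeriesOnBall
    (by exact_mod_cast h0)
  obtain ⟨s, hs0, hsq⟩ := exists_between hq
  have hs0' := hs0.le
  lift s to NNReal using hs0.le
  have h2 : HasFPowerSeriesOnBall G (FormalMultilinearSeries.ofScalars ℂ c) 0 s := by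
    refine ⟨?_, by exact_mod_cast hs0, ?_⟩
    · apply FormalMultilinearSeries.le_radius_of_summable_norm
      have := (hc (s : ℝ) (by simpa using hsq)).summable.norm
      refine this.congr (fun k => ?_)
      rw [FormalMultilinearSeries.ofScalars_norm, norm_mul, norm_pow]
      simp
    · intro y hy
      have hy' : ‖y‖ < s := by
        have : edist y 0 < s := hy
        rw [edist_eq_enorm_sub, sub_zero] at this
        have h4 : ‖y‖₊ < s := by exact_mod_cast this
        exact_mod_cast h4
      have := hc y (hy'.trans hsq)
      simpa [FormalMultilinearSeries.ofScalars_apply_eq, mul_comm] using this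
  have heq := hp.hasFPowerSeriesAt.eq_formalMultilinearSeries h2.hasFPowerSeriesAt
  have hrad : (r : ENNReal) < (FormalMultilinearSeries.ofScalars ℂ c).radius := by
    rw [← heq]
    refine lt_of_lt_of_le ?_ hp.r_le
    exact_mod_cast hr1
  obtain ⟨C, hC, hb⟩ := FormalMultilinearSeries.norm_le_div_pow_of_pos_of_lt_radius _
    (by exact_mod_cast hr) hrad
  refine ⟨C, hC, fun k => ?_⟩
  have := hb k
  rwa [FormalMultilinearSeries.ofScalars_norm] at this

/-- local complex `a_P = |P|^{-2}` -/
noncomputable def aP (P : PP Fq) : ℂ := (yy Fq : ℂ) ^ P.1.natDegree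

noncomputable def xP (u : ℂ) (P : PP Fq) : ℂ :=
  -2 * aP P + 2 * aP P ^ 2 * u ^ P.1.natDegree - aP P ^ 2 * u ^ (2 * P.1.natDegree)

noncomputable def bP (R : ℝ) (P : PP Fq) : ℝ :=
  2 * yy Fq ^ P.1.natDegree + 2 * (yy Fq ^ 2 * R) ^ P.1.natDegree
    + (yy Fq ^ 2 * R ^ 2) ^ P.1.natDegree

lemma bP_nonneg {R : ℝ} (hR : 0 ≤ R) (P : PP Fq) : 0 ≤ bP R P := by
  have := yy_pos (Fq := Fq)
  unfold bP; positivity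

lemma norm_xP_le {R : ℝ} {u : ℂ} (hu : ‖u‖ ≤ R) (P : PP Fq) : ‖xP u P‖ ≤ bP R P := by
  have hy := yy_pos (Fq := Fq)
  have ha : ‖aP P‖ = yy Fq ^ P.1.natDegree := by
    rw [aP, norm_pow, Complex.norm_real, Real.norm_of_nonneg hy.le]
  unfold xP bP
  refine (norm_sub_le _ _).trans ?_
  refine (add_le_add_left (norm_add_le _ _) _).trans ?_
  have h0 := norm_nonneg u
  have h1 : ‖(-2 : ℂ) * aP P‖ = 2 * yy Fq ^ P.1.natDegree := by
    rw [norm_mul, ha]; simp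
  have h2 : ‖2 * aP P ^ 2 * u ^ P.1.natDegree‖ ≤ 2 * (yy Fq ^ 2 * R) ^ P.1.natDegree := by
    rw [norm_mul, norm_mul, norm_pow, norm_pow, ha, ← pow_mul, mul_comm P.1.natDegree 2, pow_mul,
      mul_assoc, ← mul_pow, Complex.norm_ofNat]
    gcongr
  have h3 : ‖aP P ^ 2 * u ^ (2 * P.1.natDegree)‖ ≤ (yy Fq ^ 2 * R ^ 2) ^ P.1.natDegree := by
    rw [norm_mul, norm_pow, norm_pow, ha, ← pow_mul, mul_comm P.1.natDegree 2, pow_mul, pow_mul,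
       ← mul_pow]
    gcongr
  linarith

lemma summable_geomP {x : ℝ} (hx : 0 ≤ x) (hx1 : QQ Fq * x < 1) :
    Summable (fun P : PP Fq => x ^ P.1.natDegree) := by
  have hq := QQ_pos (Fq := Fq)
  refine (summable_fiber (fun P : PP Fq => P.1.natDegree) (fun k => QQ Fq ^ k) (fun k => x ^ k)
    (fun k => by positivity) (fun s k => by exact_mod_cast card_fiberP_le s k) ?_).1
  simp only [← mul_pow]
  exact summable_geometric_of_lt_one (by positivity) hx1

lemma summable_bP {R : ℝ} (hR : 0 ≤ R) (hR2 : R ^ 2 < QQ Fq ^ 3) : Summable (bP (Fq := Fq) R) := by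
  have hq := QQ_pos (Fq := Fq)
  have hq1 := one_lt_QQ (Fq := Fq)
  have hy := yy_pos (Fq := Fq)
  have hR3 : R < QQ Fq ^ 3 := by
    refine lt_of_pow_lt_pow_left₀ 2 (by positivity) (hR2.trans_le ?_)
    rw [← pow_mul]
    exact pow_le_pow_right₀ hq1.le (by norm_num)
  have e : QQ Fq * yy Fq ^ 2 = (QQ Fq ^ 3)⁻¹ := by
    unfold yy; field_simp
  refine ((summable_geomP hy.le QQ_mul_yy_lt).mul_left 2).add
    ((summable_geomP (by positivity) ?_).mul_left 2) |>.add (summable_geomP (by positivity) ?_)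
  · rw [← mul_assoc, e, inv_mul_lt_iff₀ (by positivity)]; linarith
  · rw [← mul_assoc, e, inv_mul_lt_iff₀ (by positivity)]; linarith

noncomputable def DD (Fq : Type) [Field Fq] [Fintype Fq] (u : ℂ) : ℂ :=
  ∑' T : Finset (PP Fq), ∏ P ∈ T, xP u P

lemma summable_norm_xP {u : ℂ} (hu : ‖u‖ ^ 2 < QQ Fq ^ 3) :
    Summable (fun P : PP Fq => ‖xP u P‖) :=
  Summable.of_nonneg_of_le (fun _ => norm_nonneg _) (fun P => norm_xP_le le_rfl P)
    (summable_bP (norm_nonneg u) hu)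

lemma hasProd_DD {u : ℂ} (hu : ‖u‖ ^ 2 < QQ Fq ^ 3) :
    HasProd (fun P : PP Fq => 1 + xP u P) (DD Fq u) :=
  hasProd_one_add_of_hasSum_prod (summable_finsetProd_of_summable_norm (summable_norm_xP hu)).hasSum

lemma diff_DD {R : ℝ} (hR : 0 ≤ R) (hR2 : R ^ 2 < QQ Fq ^ 3) :
    DifferentiableOn ℂ (DD Fq) (Metric.ball 0 R) := by
  refine Complex.differentiableOn_tsum_of_summable_norm
    (summable_finsetProd_of_summable_nonneg (bP_nonneg hR) (summable_bP hR hR2)) ?_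
    Metric.isOpen_ball ?_
  · intro T
    have : ∀ P ∈ T, DifferentiableOn ℂ (fun u => xP u P) (Metric.ball 0 R) := by
      intro P _
      unfold xP
      fun_prop
    exact DifferentiableOn.fun_finsetProd this
  · intro T w hw
    rw [norm_prod]
    refine Finset.prod_le_prod (fun _ _ => norm_nonneg _) (fun P _ => norm_xP_le ?_ P)
    simpa using (mem_ball_zero_iff.mp hw).le

lemma DD_QQ : DD Fq (QQ Fq : ℂ) = (betaq Fq : ℂ) := by
  have hq := QQ_pos (Fq := Fq)
  have hq1 := one_lt_QQ (Fq := Fq)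
  have hu : ‖((QQ Fq : ℝ) : ℂ)‖ ^ 2 < QQ Fq ^ 3 := by
    rw [Complex.norm_real, Real.norm_of_nonneg hq.le]
    exact pow_lt_pow_right₀ hq1 (by norm_num)
  let z : PP Fq → ℝ := fun P => -3 / (QQ Fq ^ P.1.natDegree) ^ 2 + 2 / (QQ Fq ^ P.1.natDegree) ^ 3
  have hz : ∀ P, xP ((QQ Fq : ℝ) : ℂ) P = ((z P : ℝ) : ℂ) := by
    intro P
    have h1 : aP P = (((QQ Fq ^ P.1.natDegree) ^ 2)⁻¹ : ℝ) := by
      unfold aP yy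
      rw [← Complex.ofReal_pow]
      congr 1
      rw [inv_pow, ← pow_mul, ← pow_mul, mul_comm]
    rw [xP, h1]
    simp only [z]
    have hne : (QQ Fq : ℂ) ≠ 0 := by exact_mod_cast hq.ne'
    rw [mul_comm 2 P.1.natDegree, pow_mul]
    push_cast
    field_simp
    ring
  have hzs : Summable (fun P => ‖z P‖) := by
    refine (summable_norm_xP hu).congr (fun P => ?_)
    rw [hz, Complex.norm_real]
  have h1 := (multipliable_one_add_of_summable hzs).hasProd
  have h2 : ∏' P, (1 + z P) = betaq Fq := by
    unfold betaq
    refine tprod_congr (fun P => ?_)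
    simp only [z]
    ring
  rw [h2] at h1
  have h3 := h1.map Complex.ofRealHom Complex.continuous_ofReal
  refine (hasProd_DD hu).unique ?_
  have h4 : (fun P : PP Fq => 1 + xP ((QQ Fq : ℝ) : ℂ) P)
      = Complex.ofRealHom ∘ fun i => 1 + z i := by
    funext P
    rw [hz]
    simp
  rw [h4]
  exact h3

end HallFF

namespace HallFF

variable {Fq : Type} [Field Fq] [Fintype Fq]

section
open scoped Classical

lemma finite_id (y u : ℂ) (V : Finset (PP Fq)) :
    ∑ S ∈ V.powerset, ∑ T ∈ V.powerset,
      (-1 : ℂ) ^ S.card * (-1) ^ T.card * y ^ dg (S ∪ T) * u ^ dg (S ∩ T)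
    = ∏ P ∈ V, (1 - 2 * y ^ P.1.natDegree + y ^ P.1.natDegree * u ^ P.1.natDegree) := by
  induction V using Finset.induction_on with
  | empty => simp [dg_empty]
  | insert P V hP ih =>
    rw [Finset.prod_insert hP, ← ih, Finset.sum_powerset_insert hP]
    simp only [Finset.sum_powerset_insert hP]
    rw [Finset.mul_sum, ← Finset.sum_add_distrib]
    refine Finset.sum_congr rfl (fun S hS => ?_)
    rw [Finset.mul_sum, ← Finset.sum_add_distrib, ← Finset.sum_add_distrib,
      ← Finset.sum_add_distrib]
    refine Finset.sum_congr rfl (fun T hT => ?_)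
    have hPS : P ∉ S := fun h => hP (Finset.mem_powerset.mp hS h)
    have hPT : P ∉ T := fun h => hP (Finset.mem_powerset.mp hT h)
    have i1 : S ∩ insert P T = S ∩ T := Finset.inter_insert_of_notMem hPS
    have i2 : insert P S ∩ T = S ∩ T := Finset.insert_inter_of_notMem hPT
    have i3 : insert P S ∩ insert P T = insert P (S ∩ T) := (Finset.insert_inter_distrib _ _ _).symm
    have u1 : S ∪ insert P T = insert P (S ∪ T) := Finset.union_insert _ _ _
    have u2 : insert P S ∪ T = insert P (S ∪ T) := Finset.insert_union _ _ _
    have u3 : insert P S ∪ insert P T = insert P (S ∪ T) := (Finset.insert_union_distrib _ _ _).symm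
    have d1 : dg (insert P (S ∪ T)) = P.1.natDegree + dg (S ∪ T) := by
      unfold dg; rw [Finset.sum_insert (by simp [hPS, hPT])]
    have d2 : dg (insert P (S ∩ T)) = P.1.natDegree + dg (S ∩ T) := by
      unfold dg; rw [Finset.sum_insert (by simp [hPS])]
    rw [i1, i2, i3, u1, u2, u3, d1, d2, Finset.card_insert_of_notMem hPS,
      Finset.card_insert_of_notMem hPT]
    ring

lemma summable_epsC {u : ℂ} (hu : ‖u‖ < QQ Fq) :
    Summable (fun p : Finset (PP Fq) × Finset (PP Fq) => (eps p : ℂ) * u ^ gd p) := by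
  apply Summable.of_norm
  refine (summable_pair (norm_nonneg u) hu).congr (fun p => ?_)
  rw [norm_mul, norm_pow, Complex.norm_real, Real.norm_eq_abs, abs_eps, gd]

end

noncomputable def EE (Fq : Type) [Field Fq] [Fintype Fq] (u : ℂ) : ℂ :=
  ∑' p : Finset (PP Fq) × Finset (PP Fq), (eps p : ℂ) * u ^ gd p

lemma tendsto_pow2 (α : Type*) : Filter.Tendsto (fun V : Finset α => V.powerset ×ˢ V.powerset)
      Filter.atTop Filter.atTop := by
  rw [Filter.tendsto_atTop]
  intro b
  classical
  filter_upwards [Filter.eventually_ge_atTop (b.sup (fun p => p.1 ∪ p.2))] with V hV p hp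
  have h1 : p.1 ∪ p.2 ⊆ b.sup (fun p => p.1 ∪ p.2) :=
    Finset.le_sup (f := fun p : Finset α × Finset α => p.1 ∪ p.2) hp
  have h2 := h1.trans hV
  rw [Finset.mem_product, Finset.mem_powerset, Finset.mem_powerset]
  exact ⟨Finset.subset_union_left.trans h2, Finset.subset_union_right.trans h2⟩

lemma hasProd_of_pairs {α : Type*} {f : Finset α × Finset α → ℂ} {g : α → ℂ} {a : ℂ}
    (h : HasSum f a)
    (hfg : ∀ V : Finset α, ∑ S ∈ V.powerset, ∑ T ∈ V.powerset, f (S, T) = ∏ P ∈ V, g P) :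
    HasProd g a := by
  have h' : Filter.Tendsto (fun s => ∑ i ∈ s, f i) Filter.atTop (nhds a) := h
  have h2 := h'.comp (tendsto_pow2 α)
  refine Filter.Tendsto.congr (fun V => ?_) h2
  rw [Function.comp_apply]
  rw [Finset.sum_product, hfg]

lemma hasProd_EE {u : ℂ} (hu : ‖u‖ < QQ Fq) :
    HasProd (fun P : PP Fq => 1 - 2 * aP P + aP P * u ^ P.1.natDegree) (EE Fq u) := by
  refine hasProd_of_pairs (summable_epsC hu).hasSum (fun V => ?_)
  unfold aP
  rw [← finite_id]
  refine Finset.sum_congr rfl (fun S _ => Finset.sum_congr rfl (fun T _ => ?_))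
  simp [eps, gd]

lemma hasProd_Z {u : ℂ} (hu : ‖u‖ < QQ Fq) :
    HasProd (fun P : PP Fq => 1 + -(aP P * u ^ P.1.natDegree)) (1 - u / QQ Fq) := by
  have hq := QQ_pos (Fq := Fq)
  have hy := yy_pos (Fq := Fq)
  apply hasProd_one_add_of_hasSum_prod
  have h1 := hasSum_mu (Fq := Fq) (x := yy Fq * u) (by
    rw [norm_mul, Complex.norm_real, Real.norm_of_nonneg hy.le, ← mul_assoc, QQ_mul_yy,
      inv_mul_lt_iff₀ hq]
    linarith)
  have e : (1 : ℂ) - u / QQ Fq = 1 - QQ Fq * (yy Fq * u) := by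
    have : (QQ Fq : ℂ) * yy Fq = (QQ Fq : ℂ)⁻¹ := by
      exact_mod_cast congrArg (fun x : ℝ => (x : ℂ)) (QQ_mul_yy (Fq := Fq))
    rw [← mul_assoc, this]; ring
  have e2 : (fun T : Finset (PP Fq) => ∏ P ∈ T, -(aP P * u ^ P.1.natDegree))
      = fun T => (-1 : ℂ) ^ T.card * (yy Fq * u) ^ dg T := by
    funext T
    rw [Finset.prod_neg, dg, ← Finset.prod_pow_eq_pow_sum]
    congr 1
    refine Finset.prod_congr rfl (fun P _ => ?_)
    rw [aP, mul_pow]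
  rw [e, e2]
  exact h1

lemma EE_mul {u : ℂ} (hu : ‖u‖ < QQ Fq) : EE Fq u * (1 - u / QQ Fq) = DD Fq u := by
  have hq1 := one_lt_QQ (Fq := Fq)
  have h := (hasProd_EE hu).mul (hasProd_Z hu)
  have hu3 : ‖u‖ ^ 2 < QQ Fq ^ 3 := by
    have : ‖u‖ ^ 2 < QQ Fq ^ 2 := by gcongr
    exact this.trans (pow_lt_pow_right₀ hq1 (by norm_num))
  refine h.unique ?_
  have e : (fun P : PP Fq => (1 - 2 * aP P + aP P * u ^ P.1.natDegree)
      * (1 + -(aP P * u ^ P.1.natDegree))) = fun P => 1 + xP u P := by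
    funext P
    unfold xP
    ring
  rw [e]
  exact hasProd_DD hu3

lemma ww_bound {r : ℝ} (hr : QQ Fq < r) (hr2 : r ^ 2 < QQ Fq ^ 3) :
    ∃ C > 0, ∀ k, |ww Fq k - betaq Fq * (QQ Fq)⁻¹ ^ k| ≤ C / r ^ k := by
  have hq := QQ_pos (Fq := Fq)
  have hr0 := hq.trans hr
  have hqc : (QQ Fq : ℂ) ≠ 0 := by exact_mod_cast hq.ne'
  -- a slightly bigger radius
  obtain ⟨R, hR1, hR2⟩ : ∃ R, r < R ∧ R ^ 2 < QQ Fq ^ 3 := by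
    refine ⟨(r + Real.sqrt (QQ Fq ^ 3)) / 2, ?_, ?_⟩
    · have := Real.lt_sqrt_of_sq_lt hr2
      linarith
    · have h1 := Real.lt_sqrt_of_sq_lt hr2
      have h2 := Real.sq_sqrt (x := QQ Fq ^ 3) (by positivity)
      nlinarith
  have hR0 : 0 < R := hr0.trans hR1
  have hqR : QQ Fq < R := hr.trans hR1
  let G : ℂ → ℂ := fun u => -(QQ Fq : ℂ) * dslope (DD Fq) (QQ Fq : ℂ) u
  have hG : DifferentiableOn ℂ G (Metric.ball 0 R) := by
    refine DifferentiableOn.const_mul ?_ _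
    rw [Complex.differentiableOn_dslope]
    · exact diff_DD hR0.le hR2
    · refine Metric.isOpen_ball.mem_nhds ?_
      rw [mem_ball_zero_iff, Complex.norm_real, Real.norm_of_nonneg hq.le]
      exact hqR
  have hc : ∀ u : ℂ, ‖u‖ < QQ Fq → HasSum (fun k =>
      ((ww Fq k - betaq Fq * (QQ Fq)⁻¹ ^ k : ℝ) : ℂ) * u ^ k) (G u) := by
    intro u hu
    have h1 := fiber_sum_c (Fq := Fq) (φ := fun k => u ^ k) (summable_epsC hu)
    have hu1 : ‖u / QQ Fq‖ < 1 := by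
      rw [norm_div, Complex.norm_real, Real.norm_of_nonneg hq.le, div_lt_one hq]
      exact hu
    have h2 := (hasSum_geometric_of_norm_lt_one hu1).mul_left (betaq Fq : ℂ)
    have h3 := h1.sub h2
    have hne : u ≠ (QQ Fq : ℂ) := by
      rintro rfl
      rw [Complex.norm_real, Real.norm_of_nonneg hq.le] at hu
      exact lt_irrefl _ hu
    have hne2 : (1 : ℂ) - u / QQ Fq ≠ 0 := by
      intro h0
      apply hne
      field_simp at h0
      linear_combination -h0
    have e : G u = EE Fq u - betaq Fq * (1 - u / QQ Fq)⁻¹ := by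
      have hE : EE Fq u = DD Fq u * (1 - u / QQ Fq)⁻¹ := by
        rw [← EE_mul hu]; field_simp
      simp only [G]
      rw [dslope_of_ne _ hne, slope_def_field, DD_QQ, hE, ← sub_mul]
      have h5 : u - (QQ Fq : ℂ) = -(QQ Fq : ℂ) * (1 - u / QQ Fq) := by field_simp; ring
      rw [h5]
      field_simp
    rw [e]
    have e2 : (fun k => ((ww Fq k - betaq Fq * (QQ Fq)⁻¹ ^ k : ℝ) : ℂ) * u ^ k)
        = fun k => (ww Fq k : ℂ) * u ^ k - betaq Fq * (u / QQ Fq) ^ k := by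
      funext k
      rw [div_pow]
      push_cast
      rw [inv_pow]
      ring
    rw [e2]
    exact h3
  obtain ⟨C, hC, hb⟩ := coeff_bound hq hc hG hr0 hR1
  refine ⟨C, hC, fun k => ?_⟩
  have := hb k
  rwa [Complex.norm_real, Real.norm_eq_abs] at this

end HallFF

namespace HallFF

variable {Fq : Type} [Field Fq] [Fintype Fq]

lemma hasSum_tail {x : ℝ} (hx : 0 ≤ x) (hx1 : x < 1) (m : ℕ) :
    HasSum (fun k => if k ≤ m then 0 else x ^ k) (x ^ (m + 1) / (1 - x)) := by
  have h := (hasSum_geometric_of_lt_one hx hx1).mul_left (x ^ (m + 1))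
  have h2 : HasSum (fun n => (fun k => if k ≤ m then 0 else x ^ k) (n + (m + 1)))
      (x ^ (m + 1) / (1 - x)) := by
    rw [div_eq_mul_inv]
    refine (congrArg (fun f => HasSum f _) (funext fun k => ?_)).mp h
    simp only
    rw [if_neg (by omega)]; ring
  have h3 := (hasSum_nat_add_iff (f := fun k => if k ≤ m then 0 else x ^ k) (m + 1)).mp h2
  have h4 : ∑ i ∈ Finset.range (m + 1), (if i ≤ m then 0 else x ^ i) = 0 := by
    apply Finset.sum_eq_zero
    intro i hi
    rw [Finset.mem_range] at hi
    rw [if_pos (by omega)]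
  rw [h4, add_zero] at h3
  exact h3

lemma main_hasSum (h : ℕ) :
    HasSum (fun k => (QQ Fq)⁻¹ ^ k * psi Fq h k)
      ((QQ Fq)⁻¹ ^ ((h + 1) / 2 + 1) / (1 - (QQ Fq)⁻¹)
        - QQ Fq ^ (h + 1) * (((QQ Fq)⁻¹ ^ 3) ^ ((h + 1) / 2 + 1) / (1 - (QQ Fq)⁻¹ ^ 3))) := by
  have hq := QQ_pos (Fq := Fq)
  have hq1 := one_lt_QQ (Fq := Fq)
  have hi : (QQ Fq)⁻¹ < 1 := inv_lt_one_of_one_lt₀ hq1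
  have hi0 : 0 ≤ (QQ Fq)⁻¹ := by positivity
  have h1 := hasSum_tail hi0 hi ((h + 1) / 2)
  have h2 := (hasSum_tail (x := (QQ Fq)⁻¹ ^ 3) (by positivity)
    (pow_lt_one₀ hi0 hi (by norm_num)) ((h + 1) / 2)).mul_left (QQ Fq ^ (h + 1))
  refine (congrArg (fun f => HasSum f _) (funext fun k => ?_)).mp (h1.sub h2)
  unfold psi yy
  by_cases hk : 2 * k ≤ h + 1
  · rw [if_pos (by omega), if_pos (by omega), if_pos hk]; simp
  · rw [if_neg (by omega), if_neg (by omega), if_neg hk]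
    rw [← inv_pow, ← pow_mul, ← pow_mul, mul_sub, mul_one]
    ring

lemma main_term (h : ℕ) :
    QQ Fq ^ (h + 1) * ((QQ Fq)⁻¹ ^ ((h + 1) / 2 + 1) / (1 - (QQ Fq)⁻¹)
        - QQ Fq ^ (h + 1) * (((QQ Fq)⁻¹ ^ 3) ^ ((h + 1) / 2 + 1) / (1 - (QQ Fq)⁻¹ ^ 3)))
      = Real.sqrt (QQ Fq ^ (h + 1)) * (1 / (1 - 1 / QQ Fq ^ 3)) * cqHall Fq h := by
  have hq := QQ_pos (Fq := Fq)
  have hq1 := one_lt_QQ (Fq := Fq)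
  unfold cqHall
  change _ = _ * (if Even h then (1 + 1 / QQ Fq ^ 2) / Real.sqrt (QQ Fq)
    else (1 + 1 / QQ Fq) / QQ Fq)
  generalize QQ Fq = Q at *
  have n1 : Q - 1 ≠ 0 := by linarith
  have n3 : Q ^ 3 - 1 ≠ 0 := by
    have : 1 < Q ^ 3 := one_lt_pow₀ hq1 (by norm_num)
    linarith
  have n1' : 1 - Q⁻¹ ≠ 0 := by
    intro h0; apply n1; field_simp at h0; linarith
  have n3' : 1 - Q⁻¹ ^ 3 ≠ 0 := by
    intro h0; apply n3; field_simp at h0; linarith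
  have n3'' : 1 - 1 / Q ^ 3 ≠ 0 := by
    intro h0; apply n3; field_simp at h0; linarith
  have f1 : 1 - Q⁻¹ = (Q - 1) / Q := by field_simp
  have f3 : 1 - Q⁻¹ ^ 3 = (Q ^ 3 - 1) / Q ^ 3 := by field_simp
  have f3' : 1 - 1 / Q ^ 3 = (Q ^ 3 - 1) / Q ^ 3 := by field_simp
  rw [f1, f3, f3']
  rcases Nat.even_or_odd' h with ⟨m, rfl | rfl⟩
  · rw [if_pos (by simp), show (2 * m + 1) / 2 = m by omega]
    have hs : Real.sqrt (Q ^ (2 * m + 1)) = Q ^ m * Real.sqrt Q := by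
      rw [pow_succ, mul_comm 2 m, pow_mul, Real.sqrt_mul (by positivity), Real.sqrt_sq (by positivity)]
    rw [hs]
    have hsq : Real.sqrt Q ≠ 0 := (Real.sqrt_pos.mpr hq).ne'
    have : Q ^ m * Real.sqrt Q * (1 / ((Q ^ 3 - 1) / Q ^ 3)) * ((1 + 1 / Q ^ 2) / Real.sqrt Q)
      = Q ^ m * (1 / ((Q ^ 3 - 1) / Q ^ 3)) * (1 + 1 / Q ^ 2) := by field_simp
    rw [this]
    simp only [inv_pow, ← pow_mul]
    rw [show 3 * (m + 1) = m + m + m + 3 by ring, show 2 * m + 1 = m + m + 1 by ring]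
    simp only [pow_add]
    have hQm : Q ^ m ≠ 0 := by positivity
    generalize Q ^ m = t at *
    field_simp
    ring
  · rw [if_neg (by simp), show (2 * m + 1 + 1) / 2 = m + 1 by omega]
    have hs : Real.sqrt (Q ^ (2 * m + 1 + 1)) = Q ^ m * Q := by
      rw [show 2 * m + 1 + 1 = (m + 1) * 2 by ring, pow_mul, Real.sqrt_sq (by positivity), pow_succ]
    rw [hs]
    simp only [inv_pow, ← pow_mul]
    rw [show 3 * (m + 1 + 1) = m + m + m + 6 by ring, show 2 * m + 1 + 1 = m + m + 2 by ring]
    simp only [pow_add]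
    have hQm : Q ^ m ≠ 0 := by positivity
    generalize Q ^ m = t at *
    field_simp
    ring

lemma tail_err {r C : ℝ} (hr : 1 < r) (hC : 0 < C) {e : ℕ → ℝ} (he : ∀ k, |e k| ≤ C / r ^ k)
    (h : ℕ) : Summable (fun k => e k * psi Fq h k) ∧
    |∑' k, e k * psi Fq h k| ≤ C / (1 - r⁻¹) * r ^ (-((h + 1 : ℕ) : ℝ) / 2) := by
  have hr0 : 0 < r := by linarith
  have hi : r⁻¹ < 1 := inv_lt_one_of_one_lt₀ hr
  have h1 := (hasSum_tail (inv_nonneg.mpr hr0.le) hi ((h + 1) / 2)).mul_left C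
  have hb : ∀ k, ‖e k * psi Fq h k‖ ≤ C * (if k ≤ (h + 1) / 2 then 0 else r⁻¹ ^ k) := by
    intro k
    rw [Real.norm_eq_abs, abs_mul]
    by_cases hk : 2 * k ≤ h + 1
    · rw [if_pos (by omega), psi, if_pos hk]; simp
    · rw [if_neg (by omega)]
      have := psi_bound (Fq := Fq) h k
      calc _ ≤ |e k| * 1 := by gcongr
        _ ≤ C * r⁻¹ ^ k := by
          rw [mul_one, inv_pow, ← div_eq_mul_inv]; exact he k
  refine ⟨Summable.of_norm_bounded h1.summable hb, ?_⟩
  have h2 := tsum_of_norm_bounded h1 hb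
  rw [Real.norm_eq_abs] at h2
  refine h2.trans ?_
  have h3 : r⁻¹ ^ ((h + 1) / 2 + 1) ≤ r ^ (-((h + 1 : ℕ) : ℝ) / 2) := by
    rw [inv_pow, ← Real.rpow_natCast, ← Real.rpow_neg hr0.le]
    apply Real.rpow_le_rpow_of_exponent_le hr.le
    have : h + 1 ≤ 2 * ((h + 1) / 2 + 1) := by omega
    have h5 : ((h + 1 : ℕ) : ℝ) ≤ 2 * (((h + 1) / 2 + 1 : ℕ) : ℝ) := by exact_mod_cast this
    linarith
  have h4 : 0 < 1 - r⁻¹ := by linarith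
  calc C * (r⁻¹ ^ ((h + 1) / 2 + 1) / (1 - r⁻¹)) = C / (1 - r⁻¹) * r⁻¹ ^ ((h + 1) / 2 + 1) := by ring
    _ ≤ _ := by gcongr

theorem final (δ : ℝ) (hδ : 0 < δ) : ∃ C : ℝ, ∀ n h : ℕ, 2 ≤ n → h + 2 ≤ n →
      |varNsqfreeHall Fq n h
          - Real.sqrt (QQ Fq ^ (h + 1)) *
              (betaq Fq / (1 - 1 / QQ Fq ^ 3)) * cqHall Fq h|
        ≤ C * ((QQ Fq ^ (h + 1)) ^ 2 * n * QQ Fq ^ (-(n : ℝ) / 3)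
            + (QQ Fq ^ (h + 1)) ^ ((1 : ℝ) / 4 + δ)) := by
  have hq := QQ_pos (Fq := Fq)
  have hq1 := one_lt_QQ (Fq := Fq)
  obtain ⟨d, hd0, hd1, hd2⟩ : ∃ d : ℝ, 0 < d ∧ d ≤ δ ∧ d ≤ 1 / 8 :=
    ⟨min δ (1/8), by positivity, min_le_left _ _, min_le_right _ _⟩
  obtain ⟨K, hK, hv⟩ := var_main (Fq := Fq)
  set r : ℝ := QQ Fq ^ (3 / 2 - 2 * d) with hr
  have hrQ : QQ Fq < r := by
    conv_lhs => rw [← Real.rpow_one (QQ Fq)]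
    exact Real.rpow_lt_rpow_of_exponent_lt hq1 (by linarith)
  have hr2 : r ^ 2 < QQ Fq ^ 3 := by
    rw [hr, ← Real.rpow_natCast, ← Real.rpow_mul hq.le, ← Real.rpow_natCast (QQ Fq) 3]
    apply Real.rpow_lt_rpow_of_exponent_lt hq1
    push_cast; linarith
  obtain ⟨C, hC, hw⟩ := ww_bound hrQ hr2
  have hr1 : 1 < r := hq1.trans hrQ
  have hr0 : 0 < r := by linarith
  have hir : 0 < 1 - r⁻¹ := by
    have := inv_lt_one_of_one_lt₀ hr1
    linarith
  refine ⟨K + C / (1 - r⁻¹), fun n h hn hh => ?_⟩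
  obtain ⟨hs, hb⟩ := tail_err (Fq := Fq) hr1 hC hw h
  have hm := main_hasSum (Fq := Fq) h
  have e1 : QQ Fq ^ (h + 1) * ∑' k, ww Fq k * psi Fq h k
      = QQ Fq ^ (h + 1) * (∑' k, (ww Fq k - betaq Fq * (QQ Fq)⁻¹ ^ k) * psi Fq h k)
        + Real.sqrt (QQ Fq ^ (h + 1)) * (betaq Fq / (1 - 1 / QQ Fq ^ 3)) * cqHall Fq h := by
    have e2 : ∑' k, ww Fq k * psi Fq h k
        = ∑' k, (ww Fq k - betaq Fq * (QQ Fq)⁻¹ ^ k) * psi Fq h k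
          + betaq Fq * ∑' k, (QQ Fq)⁻¹ ^ k * psi Fq h k := by
      rw [← tsum_mul_left, ← hs.tsum_add (hm.summable.mul_left _)]
      refine tsum_congr (fun k => ?_)
      ring
    rw [e2, mul_add, hm.tsum_eq, mul_left_comm, main_term]
    ring
  have hv1 := hv n h hn hh
  rw [e1] at hv1
  set X := ∑' k, (ww Fq k - betaq Fq * (QQ Fq)⁻¹ ^ k) * psi Fq h k
  have hX : |QQ Fq ^ (h + 1) * X| ≤ C / (1 - r⁻¹) * (QQ Fq ^ (h + 1)) ^ ((1 : ℝ) / 4 + δ) := by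
    rw [abs_mul, abs_of_pos (by positivity)]
    have h5 : QQ Fq ^ (h + 1) * r ^ (-((h + 1 : ℕ) : ℝ) / 2)
        ≤ (QQ Fq ^ (h + 1)) ^ ((1 : ℝ) / 4 + δ) := by
      rw [hr, ← Real.rpow_mul hq.le, ← Real.rpow_natCast, ← Real.rpow_add hq, ← Real.rpow_mul hq.le]
      apply Real.rpow_le_rpow_of_exponent_le hq1.le
      have : (0 : ℝ) ≤ ((h + 1 : ℕ) : ℝ) := Nat.cast_nonneg _
      nlinarith
    calc QQ Fq ^ (h + 1) * |X| ≤ QQ Fq ^ (h + 1) *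
          (C / (1 - r⁻¹) * r ^ (-((h + 1 : ℕ) : ℝ) / 2)) := by gcongr
      _ = C / (1 - r⁻¹) * (QQ Fq ^ (h + 1) * r ^ (-((h + 1 : ℕ) : ℝ) / 2)) := by ring
      _ ≤ _ := by gcongr
  have hA : 0 ≤ (QQ Fq ^ (h + 1)) ^ 2 * n * QQ Fq ^ (-(n : ℝ) / 3) := by positivity
  have hB : 0 ≤ (QQ Fq ^ (h + 1)) ^ ((1 : ℝ) / 4 + δ) := by positivity
  have hC' : 0 ≤ C / (1 - r⁻¹) := by positivity
  generalize (QQ Fq ^ (h + 1)) ^ 2 * n * QQ Fq ^ (-(n : ℝ) / 3) = A at *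
  generalize (QQ Fq ^ (h + 1)) ^ ((1 : ℝ) / 4 + δ) = B at *
  have p1 := mul_nonneg hC' hA
  have p2 := mul_nonneg hK hB
  rw [abs_le] at *
  constructor <;> nlinarith [hv1.1, hv1.2, hX.1, hX.2]

end HallFF

/-- Hall's theorem for `𝔽_q[t]`, fixed `q`, large degree: for every `δ > 0`
there is `C = C(q,δ)` with, for all `n ≥ 2` and `0 ≤ h ≤ n-2` and `H = q^{h+1}`,
`|Var(N_{μ²}(•;h)) - √H·(β_q/(1-q⁻³))·c_q(h)| ≤ C(H²·n·q^{-n/3} + H^{1/4+δ})`. -/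
theorem hall_theorem_function_field (Fq : Type) [Field Fq] [Fintype Fq]
    (hodd : Odd (Fintype.card Fq)) :
    ∀ δ : ℝ, 0 < δ → ∃ C : ℝ, ∀ n h : ℕ, 2 ≤ n → h + 2 ≤ n →
      |varNsqfreeHall Fq n h
          - Real.sqrt ((Fintype.card Fq : ℝ) ^ (h + 1)) *
              (betaq Fq / (1 - 1 / (Fintype.card Fq : ℝ) ^ 3)) * cqHall Fq h|
        ≤ C * (((Fintype.card Fq : ℝ) ^ (h + 1)) ^ 2 * n *
              (Fintype.card Fq : ℝ) ^ (-(n : ℝ) / 3)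
            + ((Fintype.card Fq : ℝ) ^ (h + 1)) ^ ((1 : ℝ) / 4 + δ)) := by
  intro δ hδ
  exact HallFF.final δ hδ
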